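/- arXiv:1211.1559 — 3 statements merged into one kernel-verified Lean document; each statement's English description precedes it below -/
import Mathlib

section
/- Let X be a Banach space of type p with 1 < p ≤ 2, let 0 < r < p' and 0 < s < ∞. Then for every precompact subset A ⊂ X, if (e_n(A))_n ∈ l_{r,s}, then (e_n(aco(A)))_n ∈ l_{p',s,α}, where α = 1/s + 1/p' − 1/r. -/
open MeasureTheory

/-- The `n`-th entropy number of a subset `A` of a pseudometric space. -/
noncomputable def entropyNum {X : Type*} [PseudoMetricSpace X] (A : Set X) (n : ℕ) : ℝ :=
  sInf {ε : ℝ | 0 ≤ ε ∧ ∃ T : Finset X, T.card ≤ n ∧ A ⊆ ⋃ x ∈ T, Metric.closedBall x ε}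

/-- The `n`-th dyadic entropy number of a subset `A`. -/
noncomputable def dyadEntropyNum {X : Type*} [PseudoMetricSpace X] (A : Set X) (n : ℕ) : ℝ :=
  entropyNum A (2 ^ (n - 1))

/-- The `n`-th entropy number of a bounded linear operator. -/
noncomputable def opEntropyNum {X Y : Type*} [SeminormedAddCommGroup X] [SeminormedAddCommGroup Y]
    [NormedSpace ℝ X] [NormedSpace ℝ Y] (T : X →L[ℝ] Y) (n : ℕ) : ℝ :=
  entropyNum (T '' Metric.closedBall 0 1) n

/-- The `n`-th dyadic entropy number of a bounded linear operator. -/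
noncomputable def opDyadEntropyNum {X Y : Type*} [SeminormedAddCommGroup X]
    [SeminormedAddCommGroup Y] [NormedSpace ℝ X] [NormedSpace ℝ Y]
    (T : X →L[ℝ] Y) (n : ℕ) : ℝ :=
  opEntropyNum T (2 ^ (n - 1))

/-- The absolutely convex hull of a set: all finite sums `∑ λ i • a i` with `∑ |λ i| ≤ 1`. -/
def absConvHull {X : Type*} [AddCommGroup X] [Module ℝ X] (A : Set X) : Set X :=
  {x | ∃ (n : ℕ) (a : Fin n → X) (lam : Fin n → ℝ),
    (∀ i, a i ∈ A) ∧ (∑ i, |lam i|) ≤ 1 ∧ x = ∑ i, lam i • a i}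

/-- The `i`-th Rademacher function. -/
noncomputable def rademacherFn (i : ℕ) (t : ℝ) : ℝ :=
  Real.sign (Real.sin (2 ^ i * Real.pi * t))

/-- `X` is of type `p` with constant `ρ`. -/
def IsTypePWith (X : Type*) [SeminormedAddCommGroup X] [NormedSpace ℝ X] (p ρ : ℝ) : Prop :=
  ∀ (k : ℕ) (x : Fin k → X),
    (∫ t in (0:ℝ)..1, ‖∑ i : Fin k, rademacherFn (i.1 + 1) t • x i‖) ≤
      ρ * (∑ i : Fin k, ‖x i‖ ^ p) ^ (1 / p)

/-- `X` is a Banach space of type `p`. -/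
def IsTypeP (X : Type*) [SeminormedAddCommGroup X] [NormedSpace ℝ X] (p : ℝ) : Prop :=
  ∃ ρ > 0, IsTypePWith X p ρ

/-- Membership in the generalized Lorentz sequence space `l_{r,s,α}`, `0 < s < ∞`:
`∑_{n ≥ 1} (log₂(n+1))^{-αs} n^{s/r-1} ξ_n^s < ∞`. -/
def MemLorentz (r s α : ℝ) (ξ : ℕ → ℝ) : Prop :=
  Summable fun n : ℕ =>
    (Real.logb 2 ((n : ℝ) + 2)) ^ (-(α * s)) * ((n : ℝ) + 1) ^ (s / r - 1) * ξ (n + 1) ^ s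

/-- Membership in the generalized Lorentz sequence space `l_{r,∞,α}`:
`sup_{n ≥ 1} (log₂(n+1))^{-α} n^{1/r} ξ_n < ∞`. -/
def MemLorentzTop (r α : ℝ) (ξ : ℕ → ℝ) : Prop :=
  ∃ C : ℝ, ∀ n : ℕ, 1 ≤ n →
    (Real.logb 2 ((n : ℝ) + 1)) ^ (-α) * (n : ℝ) ^ (1 / r) * ξ n ≤ C

/-- The `n`-th Kolmogorov number of a bounded linear operator. -/
noncomputable def kolmogorovNum {X Y : Type*} [SeminormedAddCommGroup X] [NormedSpace ℝ X]
    [NormedAddCommGroup Y] [NormedSpace ℝ Y] (T : X →L[ℝ] Y) (n : ℕ) : ℝ :=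
  sInf {c : ℝ | ∃ F : Submodule ℝ Y, Module.rank ℝ F < (n : Cardinal) ∧
    ∀ x ∈ Metric.closedBall (0 : X) 1, Metric.infDist (T x) (F : Set Y) ≤ c}

/-- The `l`-norm of an operator from a finite-dimensional Euclidean space. -/
noncomputable def ellNormFin {Y : Type*} [SeminormedAddCommGroup Y] [NormedSpace ℝ Y] {n : ℕ}
    (S : EuclideanSpace ℝ (Fin n) →L[ℝ] Y) : ℝ :=
  (∫ x : Fin n → ℝ, ‖S ((WithLp.equiv 2 (Fin n → ℝ)).symm x)‖ ^ 2
      ∂(Measure.pi fun _ : Fin n => ProbabilityTheory.gaussianReal 0 1)) ^ ((1 : ℝ) / 2)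

/-- The `l`-norm of an operator between Banach spaces. -/
noncomputable def ellNorm {X Y : Type*} [SeminormedAddCommGroup X] [NormedSpace ℝ X]
    [SeminormedAddCommGroup Y] [NormedSpace ℝ Y] (T : X →L[ℝ] Y) : ℝ :=
  sSup {c : ℝ | ∃ (n : ℕ) (A : EuclideanSpace ℝ (Fin n) →L[ℝ] X),
    ‖A‖ ≤ 1 ∧ c = ellNormFin (T.comp A)}

/-- The `n`-th approximation number of `T` with respect to the `l`-norm. -/
noncomputable def approxNumEll {X Y : Type*} [SeminormedAddCommGroup X] [NormedSpace ℝ X]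
    [SeminormedAddCommGroup Y] [NormedSpace ℝ Y] (T : X →L[ℝ] Y) (n : ℕ) : ℝ :=
  sInf {c : ℝ | ∃ A : X →L[ℝ] Y,
    Module.rank ℝ (LinearMap.range (A : X →ₗ[ℝ] Y)) < (n : Cardinal) ∧ c = ellNorm (T - A)}

/-- `S` admits a finite `ε`-net of cardinality at most `m`. -/
def HasNet {X : Type*} [SeminormedAddCommGroup X] (S : Set X) (m : ℕ) (ε : ℝ) : Prop :=
  ∃ T : Finset X, T.card ≤ m ∧ ∀ x ∈ S, ∃ y ∈ T, ‖x - y‖ ≤ ε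

namespace HasNet

variable {X : Type*} [SeminormedAddCommGroup X]

lemma mono {S S' : Set X} {m m' : ℕ} {ε ε' : ℝ} (h : HasNet S m ε) (hS : S' ⊆ S)
    (hm : m ≤ m') (hε : ε ≤ ε') : HasNet S' m' ε' := by
  obtain ⟨T, hT, h⟩ := h
  refine ⟨T, hT.trans hm, fun x hx => ?_⟩
  obtain ⟨y, hy, hxy⟩ := h x (hS hx)
  exact ⟨y, hy, hxy.trans hε⟩

open Pointwise in
lemma add {S S' : Set X} {m m' : ℕ} {ε ε' : ℝ} (h : HasNet S m ε) (h' : HasNet S' m' ε') :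
    HasNet (S + S') (m * m') (ε + ε') := by
  classical
  obtain ⟨T, hT, h⟩ := h
  obtain ⟨T', hT', h'⟩ := h'
  refine ⟨T + T', Finset.card_add_le.trans (Nat.mul_le_mul hT hT'), ?_⟩
  rintro _ ⟨x, hx, x', hx', rfl⟩
  obtain ⟨y, hy, hxy⟩ := h x hx
  obtain ⟨y', hy', hxy'⟩ := h' x' hx'
  refine ⟨y + y', Finset.add_mem_add hy hy', ?_⟩
  calc ‖x + x' - (y + y')‖ = ‖(x - y) + (x' - y')‖ := by congr 1; abel
    _ ≤ _ := (norm_add_le _ _).trans (add_le_add hxy hxy')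

lemma entropyNum_le {S : Set X} {m : ℕ} {ε : ℝ} (h : HasNet S m ε) (hε : 0 ≤ ε) :
    entropyNum S m ≤ ε := by
  obtain ⟨T, hT, h⟩ := h
  refine csInf_le ⟨0, fun _ h => h.1⟩ ⟨hε, T, hT, fun x hx => ?_⟩
  obtain ⟨y, hy, hxy⟩ := h x hx
  simp only [Set.mem_iUnion]
  exact ⟨y, hy, by rwa [mem_closedBall_iff_norm]⟩

lemma of_norm_le {S : Set X} {ε : ℝ} (h : ∀ x ∈ S, ‖x‖ ≤ ε) : HasNet S 1 ε :=
  ⟨{0}, by simp, fun x hx => ⟨0, by simp, by simpa using h x hx⟩⟩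

end HasNet

section EntropyNumbers

variable {X : Type*} [SeminormedAddCommGroup X]

lemma entropyNum_nonneg {X : Type*} [PseudoMetricSpace X] (A : Set X) (n : ℕ) :
    0 ≤ entropyNum A n :=
  Real.sInf_nonneg fun _ h => h.1

lemma dyadEntropyNum_nonneg {X : Type*} [PseudoMetricSpace X] (A : Set X) (n : ℕ) :
    0 ≤ dyadEntropyNum A n :=
  entropyNum_nonneg A _

lemma HasNet.of_entropyNum_lt {A : Set X} (hA : Bornology.IsBounded A) {n : ℕ} (hn : 1 ≤ n)
    {ε : ℝ} (h : entropyNum A n < ε) : HasNet A n ε := by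
  obtain ⟨R, hR0, hR⟩ := hA.exists_pos_norm_le
  obtain ⟨δ, ⟨-, T, hT, hAT⟩, hδε⟩ := exists_lt_of_csInf_lt
    (s := {ε : ℝ | 0 ≤ ε ∧ ∃ T : Finset X, T.card ≤ n ∧ A ⊆ ⋃ x ∈ T, Metric.closedBall x ε})
    ⟨R, hR0.le, {0}, by simpa using hn, fun x hx => by simpa using hR x hx⟩ h
  refine ⟨T, hT, fun x hx => ?_⟩
  obtain ⟨y, hy, hxy⟩ := Set.mem_iUnion₂.1 (hAT hx)
  exact ⟨y, hy, (mem_closedBall_iff_norm.1 hxy).trans hδε.le⟩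

lemma dyadEntropyNum_antitone {A : Set X} (hA : Bornology.IsBounded A) :
    Antitone (dyadEntropyNum A) := by
  intro m n hmn
  refine le_of_forall_gt fun ε hε => ?_
  obtain ⟨δ, hδ, hδε⟩ := exists_between hε
  exact (((HasNet.of_entropyNum_lt hA Nat.one_le_two_pow hδ).mono subset_rfl
    (Nat.pow_le_pow_right two_pos (by omega)) le_rfl).entropyNum_le
    ((dyadEntropyNum_nonneg A m).trans hδ.le)).trans_lt hδε

end EntropyNumbers

section AbsConvHull

variable {X : Type*} [SeminormedAddCommGroup X] [NormedSpace ℝ X]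

lemma norm_le_of_mem_absConvHull {S : Set X} {ε : ℝ} (hε : 0 ≤ ε) (h : ∀ x ∈ S, ‖x‖ ≤ ε) :
    ∀ x ∈ absConvHull S, ‖x‖ ≤ ε := by
  rintro _ ⟨n, a, lam, ha, hlam, rfl⟩
  calc ‖∑ i, lam i • a i‖ ≤ ∑ i, |lam i| * ε := norm_sum_le_of_le _ fun i _ => by
        rw [norm_smul, Real.norm_eq_abs]
        exact mul_le_mul_of_nonneg_left (h _ (ha i)) (abs_nonneg _)
    _ = (∑ i, |lam i|) * ε := (Finset.sum_mul ..).symm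
    _ ≤ ε := mul_le_of_le_one_left hε hlam

lemma absConvHull_mono {S S' : Set X} (h : S ⊆ S') : absConvHull S ⊆ absConvHull S' := by
  rintro _ ⟨n, a, lam, ha, hlam, rfl⟩
  exact ⟨n, a, lam, fun i => h (ha i), hlam, rfl⟩

open Pointwise in
lemma absConvHull_image_add_subset (f g : X → X) (A : Set X) :
    absConvHull ((fun a => f a + g a) '' A) ⊆ absConvHull (f '' A) + absConvHull (g '' A) := by
  rintro _ ⟨n, a, lam, ha, hlam, rfl⟩
  choose b hb hba using ha
  refine ⟨∑ i, lam i • f (b i), ⟨n, _, lam, fun i => ⟨b i, hb i, rfl⟩, hlam, rfl⟩,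
    ∑ i, lam i • g (b i), ⟨n, _, lam, fun i => ⟨b i, hb i, rfl⟩, hlam, rfl⟩, ?_⟩
  simp only [← Finset.sum_add_distrib, ← smul_add]
  simp only [hba]

lemma exists_coeff_of_mem_absConvHull (D : Finset X) {x : X} (hx : x ∈ absConvHull (D : Set X)) :
    ∃ μ : D → ℝ, (∀ d, |μ d| ≤ 1) ∧ x = ∑ d, μ d • (d : X) := by
  classical
  obtain ⟨n, a, lam, ha, hlam, rfl⟩ := hx
  let b : Fin n → D := fun i => ⟨a i, ha i⟩
  refine ⟨fun d => ∑ i with b i = d, lam i, fun d => ?_, ?_⟩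
  · calc |∑ i with b i = d, lam i| ≤ ∑ i with b i = d, |lam i| := Finset.abs_sum_le_sum_abs _ _
      _ ≤ ∑ i, |lam i| :=
        Finset.sum_le_sum_of_subset_of_nonneg (Finset.filter_subset _ _) fun _ _ _ => abs_nonneg _
      _ ≤ 1 := hlam
  · rw [← Finset.sum_fiberwise Finset.univ b]
    refine Finset.sum_congr rfl fun d _ => ?_
    rw [Finset.sum_smul]
    refine Finset.sum_congr rfl fun i hi => ?_
    rw [← (Finset.mem_filter.1 hi).2]

/-- Rounding the coefficients to multiples of `1 / Q`. -/
lemma HasNet.absConvHull_grid (D : Finset X) {R : ℝ} (hD : ∀ d ∈ D, ‖d‖ ≤ R)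
    {Q : ℕ} (hQ : 0 < Q) :
    HasNet (absConvHull (D : Set X)) ((2 * Q + 1) ^ D.card) (D.card * (R / Q)) := by
  classical
  have hQ' : (0 : ℝ) < Q := by exact_mod_cast hQ
  refine ⟨(Fintype.piFinset fun _ : D => Finset.Icc (-(Q : ℤ)) Q).image
    fun z => ∑ d : D, ((z d : ℝ) / Q) • (d : X), ?_, fun x hx => ?_⟩
  · refine Finset.card_image_le.trans (le_of_eq ?_)
    rw [Fintype.card_piFinset]
    simp only [Int.card_Icc, Finset.prod_const, Finset.card_univ, Fintype.card_coe]
    congr 1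
    omega
  · obtain ⟨μ, hμ, rfl⟩ := exists_coeff_of_mem_absConvHull D hx
    refine ⟨_, Finset.mem_image_of_mem _ (a := fun d => ⌊μ d * Q⌋) ?_, ?_⟩
    · refine Fintype.mem_piFinset.2 fun d => Finset.mem_Icc.2 ⟨?_, ?_⟩
      · refine Int.le_floor.2 ?_
        push_cast
        nlinarith [(abs_le.1 (hμ d)).1]
      · have : (⌊μ d * Q⌋ : ℝ) ≤ (Q : ℤ) := (Int.floor_le _).trans (by
          push_cast
          nlinarith [(abs_le.1 (hμ d)).2])
        exact_mod_cast this
    · rw [← Finset.sum_sub_distrib]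
      refine (norm_sum_le_of_le (f := fun d : D => μ d • (d : X) - ((⌊μ d * Q⌋ : ℝ) / Q) • (d : X))
        (n := fun _ => R / Q) _ fun d _ => ?_).trans (by simp)
      rw [← sub_smul, norm_smul, Real.norm_eq_abs, div_eq_inv_mul R]
      refine mul_le_mul ?_ (hD d d.2) (norm_nonneg _) (by positivity)
      rw [show μ d - (⌊μ d * Q⌋ : ℝ) / Q = (Q : ℝ)⁻¹ * Int.fract (μ d * Q) by
        rw [Int.fract]; field_simp, abs_mul, abs_of_pos (inv_pos.2 hQ'),
        abs_of_nonneg (Int.fract_nonneg _)]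
      exact mul_le_of_le_one_right (by positivity) (Int.fract_lt_one _).le

end AbsConvHull

section Maurey

variable {X : Type*} [NormedAddCommGroup X] [NormedSpace ℝ X]

lemma sum_pi_fin_succ {ι M : Type*} [Fintype ι] [AddCommMonoid M] {k : ℕ}
    (F : (Fin (k + 1) → ι) → M) :
    ∑ f, F f = ∑ c, ∑ g : Fin k → ι, F (Fin.cons c g) := by
  rw [← (Fin.consEquiv fun _ : Fin (k + 1) => ι).sum_comp, Fintype.sum_prod_type]
  rfl

lemma sum_pi_prod_eq_one {ι : Type*} [Fintype ι] {w : ι → ℝ} (hw : ∑ c, w c = 1) (k : ℕ) :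
    ∑ f : Fin k → ι, ∏ j, w (f j) = 1 := by
  induction k with
  | zero => simp
  | succ k ih =>
    rw [sum_pi_fin_succ]
    simp [Fin.prod_univ_succ, ← Finset.mul_sum, ih, hw]

lemma sum_pi_prod_smul_sum {ι : Type*} [Fintype ι] {w : ι → ℝ} (hw : ∑ c, w c = 1) (u : ι → X)
    (k : ℕ) :
    ∑ f : Fin k → ι, (∏ j, w (f j)) • ∑ j, u (f j) = (k : ℝ) • ∑ c, w c • u c := by
  induction k with
  | zero => simp
  | succ k ih =>
    rw [sum_pi_fin_succ]
    simp only [Fin.prod_univ_succ, Fin.sum_univ_succ, Fin.cons_zero, Fin.cons_succ, smul_add,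
      Finset.sum_add_distrib, ← Finset.sum_smul, mul_smul, ← Finset.smul_sum, ih,
      sum_pi_prod_eq_one hw, hw]
    push_cast
    simp only [one_smul, add_smul]
    rw [add_comm]

/-- Symmetrization: the mean distance of two independent samples does not exceed twice the mean
of any signed sum. -/
lemma sum_sum_norm_sub_le {ι : Type*} [Fintype ι] {w : ι → ℝ} (hw0 : ∀ c, 0 ≤ w c)
    (hw : ∑ c, w c = 1) (u : ι → X) {k : ℕ} {σ : Fin k → ℝ} (hσ : ∀ j, σ j = 1 ∨ σ j = -1) :
    ∑ f : Fin k → ι, ∑ g : Fin k → ι, (∏ j, w (f j)) * (∏ j, w (g j)) *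
        ‖∑ j, u (f j) - ∑ j, u (g j)‖ ≤
      2 * ∑ f : Fin k → ι, (∏ j, w (f j)) * ‖∑ j, σ j • u (f j)‖ := by
  classical
  let e : (Fin k → ι × ι) ≃ (Fin k → ι × ι) :=
    Equiv.piCongrRight fun j => if σ j = 1 then Equiv.refl _ else Equiv.prodComm ι ι
  have hswap : ∑ f : Fin k → ι, ∑ g : Fin k → ι, (∏ j, w (f j)) * (∏ j, w (g j)) *
        ‖∑ j, u (f j) - ∑ j, u (g j)‖ =
      ∑ f : Fin k → ι, ∑ g : Fin k → ι, (∏ j, w (f j)) * (∏ j, w (g j)) *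
        ‖∑ j, σ j • u (f j) - ∑ j, σ j • u (g j)‖ := by
    rw [← Fintype.sum_prod_type', ← Fintype.sum_prod_type']
    rw [← (Equiv.arrowProdEquivProdArrow (Fin k) (fun _ => ι) (fun _ => ι)).sum_comp,
      ← (Equiv.arrowProdEquivProdArrow (Fin k) (fun _ => ι) (fun _ => ι)).sum_comp]
    rw [← e.sum_comp]
    refine Finset.sum_congr rfl fun h _ => ?_
    simp only [Equiv.arrowProdEquivProdArrow, Equiv.coe_fn_mk, ← Finset.prod_mul_distrib,
      ← Finset.sum_sub_distrib]
    congr 1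
    · refine Finset.prod_congr rfl fun j _ => ?_
      by_cases hj : σ j = 1 <;> simp [e, hj, mul_comm]
    · congr 1
      refine Finset.sum_congr rfl fun j _ => ?_
      by_cases hj : σ j = 1
      · simp [e, hj]
      · simp only [e, hj, Equiv.piCongrRight_apply, Pi.map_apply, if_false, Equiv.prodComm_apply,
          Prod.fst_swap, Prod.snd_swap, ← smul_sub]
        rw [(hσ j).resolve_left hj, neg_smul, one_smul, neg_sub]
  rw [hswap]
  have hW : ∀ f : Fin k → ι, 0 ≤ ∏ j, w (f j) := fun f => Finset.prod_nonneg fun j _ => hw0 _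
  have h1 := sum_pi_prod_eq_one hw k
  calc _ ≤ ∑ f : Fin k → ι, ∑ g : Fin k → ι, ((∏ j, w (g j)) * ((∏ j, w (f j)) *
          ‖∑ j, σ j • u (f j)‖) + (∏ j, w (f j)) * ((∏ j, w (g j)) * ‖∑ j, σ j • u (g j)‖)) := by
        refine Finset.sum_le_sum fun f _ => Finset.sum_le_sum fun g _ => ?_
        have := mul_le_mul_of_nonneg_left (norm_sub_le (∑ j, σ j • u (f j)) (∑ j, σ j • u (g j)))
          (mul_nonneg (hW f) (hW g))
        linarith
    _ = _ := by
        simp only [Finset.sum_add_distrib, ← Finset.mul_sum, ← Finset.sum_mul, h1]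
        ring

lemma ae_rademacherFn_eq (i : ℕ) :
    ∀ᵐ t : ℝ, rademacherFn i t = 1 ∨ rademacherFn i t = -1 := by
  have hc : (Set.range fun n : ℤ => (n : ℝ) / 2 ^ i).Countable := Set.countable_range _
  filter_upwards [hc.ae_notMem volume] with t ht
  have h0 : Real.sin (2 ^ i * Real.pi * t) ≠ 0 := by
    intro h
    obtain ⟨n, hn⟩ := Real.sin_eq_zero_iff.1 h
    refine ht ⟨n, ?_⟩
    have : (n : ℝ) = 2 ^ i * t := mul_right_cancel₀ Real.pi_ne_zero (by linarith)
    simp only [this]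
    field_simp
  unfold rademacherFn
  rcases h0.lt_or_gt with h | h
  · exact Or.inr (Real.sign_of_neg h)
  · exact Or.inl (Real.sign_of_pos h)

lemma measurable_rademacherFn (i : ℕ) : Measurable (rademacherFn i) := by
  have : Measurable Real.sign := by
    unfold Real.sign
    exact Measurable.ite measurableSet_Iio measurable_const
      (Measurable.ite measurableSet_Ioi measurable_const measurable_const)
  exact this.comp (by fun_prop)

lemma abs_rademacherFn_le (i : ℕ) (t : ℝ) : |rademacherFn i t| ≤ 1 := by
  unfold rademacherFn
  rcases Real.sign_apply_eq (Real.sin (2 ^ i * Real.pi * t)) with h | h | h <;> simp [h]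

lemma intervalIntegrable_norm_rademacher_sum {k : ℕ} (x : Fin k → X) :
    IntervalIntegrable (fun t => ‖∑ i : Fin k, rademacherFn (i.1 + 1) t • x i‖) volume 0 1 := by
  have h : ∀ i : Fin k, IntervalIntegrable (fun t => rademacherFn (i.1 + 1) t • x i)
      volume 0 1 := by
    intro i
    have : IntervalIntegrable (rademacherFn (i.1 + 1)) volume 0 1 :=
      (intervalIntegrable_const (c := (1 : ℝ))).mono_fun
        (measurable_rademacherFn _).aestronglyMeasurable
        (Filter.Eventually.of_forall fun t => by
          simpa using abs_rademacherFn_le _ t)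
    exact ⟨this.1.smul_const _, this.2.smul_const _⟩
  have := IntervalIntegrable.sum Finset.univ fun i _ => h i
  simpa [Finset.sum_fn] using this.norm

/-- Empirical approximation of a convex combination in a space of type `p`. -/
lemma IsTypePWith.exists_norm_sub_sum_le {p ρ : ℝ} (hp : 0 < p)
    (hρ : 0 ≤ ρ) (hX : IsTypePWith X p ρ) {ι : Type*} [Fintype ι] {w : ι → ℝ}
    (hw0 : ∀ c, 0 ≤ w c) (hw : ∑ c, w c = 1) {u : ι → X} {a : ℝ} (ha : 0 ≤ a)
    (hu : ∀ c, ‖u c‖ ≤ a) (k : ℕ) :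
    ∃ f : Fin k → ι, ‖(k : ℝ) • ∑ c, w c • u c - ∑ j, u (f j)‖ ≤
      2 * (ρ * ((k : ℝ) ^ (1 / p) * a)) := by
  classical
  set B := ρ * ((k : ℝ) ^ (1 / p) * a)
  have hW : ∀ f : Fin k → ι, 0 ≤ ∏ j, w (f j) := fun f => Finset.prod_nonneg fun j _ => hw0 _
  have h1 := sum_pi_prod_eq_one hw k
  have htype : ∀ f : Fin k → ι,
      ∫ t in (0:ℝ)..1, ‖∑ i : Fin k, rademacherFn (i.1 + 1) t • u (f i)‖ ≤ B := by
    intro f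
    refine (hX k fun i => u (f i)).trans (mul_le_mul_of_nonneg_left ?_ hρ)
    calc (∑ i : Fin k, ‖u (f i)‖ ^ p) ^ (1 / p) ≤ (∑ _i : Fin k, a ^ p) ^ (1 / p) := by
          gcongr with i
          exact hu _
      _ = (k : ℝ) ^ (1 / p) * a := by
          rw [Finset.sum_const, Finset.card_univ, Fintype.card_fin, nsmul_eq_mul,
            Real.mul_rpow (by positivity) (by positivity), ← Real.rpow_mul ha,
            mul_one_div_cancel hp.ne', Real.rpow_one]
  set Lhs := ∑ f : Fin k → ι, ∑ g : Fin k → ι, (∏ j, w (f j)) * (∏ j, w (g j)) *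
        ‖∑ j, u (f j) - ∑ j, u (g j)‖ with hLhs
  have hbound : Lhs ≤ 2 * B := by
    have hInt : ∀ f ∈ (Finset.univ : Finset (Fin k → ι)), IntervalIntegrable (fun t =>
        (∏ j, w (f j)) * ‖∑ i : Fin k, rademacherFn (i.1 + 1) t • u (f i)‖) volume 0 1 :=
      fun f _ => (intervalIntegrable_norm_rademacher_sum fun i => u (f i)).const_mul _
    have hae : ∀ᵐ t : ℝ, Lhs ≤ 2 * ∑ f : Fin k → ι, (∏ j, w (f j)) *
        ‖∑ i : Fin k, rademacherFn (i.1 + 1) t • u (f i)‖ := by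
      have : ∀ᵐ t : ℝ, ∀ i : Fin k,
          rademacherFn (i.1 + 1) t = 1 ∨ rademacherFn (i.1 + 1) t = -1 :=
        ae_all_iff.2 fun i => ae_rademacherFn_eq _
      filter_upwards [this] with t ht
      exact sum_sum_norm_sub_le hw0 hw u ht
    have hI : IntervalIntegrable (fun t => ∑ f : Fin k → ι, (∏ j, w (f j)) *
        ‖∑ i : Fin k, rademacherFn (i.1 + 1) t • u (f i)‖) volume 0 1 := by
      simpa [Finset.sum_fn] using IntervalIntegrable.sum Finset.univ hInt
    have := intervalIntegral.integral_mono_ae (μ := volume) zero_le_one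
      (intervalIntegrable_const (c := Lhs)) (hI.const_mul 2) hae
    rw [intervalIntegral.integral_const, sub_zero, one_smul,
      intervalIntegral.integral_const_mul, intervalIntegral.integral_finsetSum hInt] at this
    refine this.trans (mul_le_mul_of_nonneg_left ?_ zero_le_two)
    calc _ ≤ ∑ f : Fin k → ι, (∏ j, w (f j)) * B := by
          refine Finset.sum_le_sum fun f _ => ?_
          rw [intervalIntegral.integral_const_mul]
          exact mul_le_mul_of_nonneg_left (htype f) (hW f)
      _ = B := by rw [← Finset.sum_mul, h1, one_mul]
  obtain ⟨f, hf⟩ : ∃ f : Fin k → ι,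
      ∑ g : Fin k → ι, (∏ j, w (g j)) * ‖∑ j, u (f j) - ∑ j, u (g j)‖ ≤ 2 * B := by
    by_contra! hcon
    refine hbound.not_gt ?_
    have hpos : ∃ f : Fin k → ι, 0 < ∏ j, w (f j) := by
      by_contra! h
      have := Finset.sum_nonpos fun (f : Fin k → ι) (_ : f ∈ Finset.univ) => h f
      linarith
    obtain ⟨f₀, hf₀⟩ := hpos
    calc 2 * B = ∑ f : Fin k → ι, (∏ j, w (f j)) * (2 * B) := by
          rw [← Finset.sum_mul, h1, one_mul]
      _ < ∑ f : Fin k → ι, (∏ j, w (f j)) *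
          ∑ g : Fin k → ι, (∏ j, w (g j)) * ‖∑ j, u (f j) - ∑ j, u (g j)‖ :=
        Finset.sum_lt_sum (fun f _ => mul_le_mul_of_nonneg_left (hcon f).le (hW f))
          ⟨f₀, Finset.mem_univ _, mul_lt_mul_of_pos_left (hcon f₀) hf₀⟩
      _ = Lhs := by simp only [hLhs, Finset.mul_sum, mul_assoc]
  refine ⟨f, ?_⟩
  calc ‖(k : ℝ) • ∑ c, w c • u c - ∑ j, u (f j)‖
      = ‖∑ g : Fin k → ι, (∏ j, w (g j)) • (∑ j, u (g j) - ∑ j, u (f j))‖ := by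
        simp only [smul_sub, Finset.sum_sub_distrib, ← Finset.sum_smul, h1, one_smul,
          sum_pi_prod_smul_sum hw]
    _ ≤ ∑ g : Fin k → ι, (∏ j, w (g j)) * ‖∑ j, u (f j) - ∑ j, u (g j)‖ :=
        norm_sum_le_of_le _ fun g _ => by
          rw [norm_smul, Real.norm_of_nonneg (hW g), norm_sub_rev]
    _ ≤ _ := hf

/-- Maurey's empirical method for the absolutely convex hull of a finite set. -/
lemma IsTypePWith.hasNet_absConvHull {p ρ : ℝ} (hp : 1 < p)
    (hρ : 0 ≤ ρ) (hX : IsTypePWith X p ρ) (D : Finset X) {a : ℝ} (ha : 0 ≤ a)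
    (hD : ∀ d ∈ D, ‖d‖ ≤ a) {M : ℕ} (hM : D.card ≤ M) (k : ℕ) :
    HasNet (absConvHull (D : Set X)) ((2 * M + 1) ^ k)
      ((4 * ρ + 1) * a * ((k : ℝ) + 1) ^ (1 / p - 1)) := by
  classical
  rcases k.eq_zero_or_pos with rfl | hk
  · refine (HasNet.of_norm_le (norm_le_of_mem_absConvHull ha hD)).mono subset_rfl (by simp) ?_
    simp only [CharP.cast_eq_zero, zero_add, Real.one_rpow, mul_one]
    nlinarith [mul_nonneg hρ ha]
  have hk' : (0 : ℝ) < k := by exact_mod_cast hk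
  let V : Finset X := insert 0 (D ∪ D.image fun d => -d)
  have hV : V.card ≤ 2 * M + 1 := by
    have h1 := Finset.card_insert_le (0 : X) (D ∪ D.image fun d => -d)
    have h2 := Finset.card_union_le D (D.image fun d => -d)
    have h3 : (D.image fun d => -d).card ≤ D.card := Finset.card_image_le
    simp only [V]
    omega
  refine ⟨(Fintype.piFinset fun _ : Fin k => V).image fun v => (k : ℝ)⁻¹ • ∑ j, v j, ?_, ?_⟩
  · refine Finset.card_image_le.trans ?_
    rw [Fintype.card_piFinset]
    simpa using Nat.pow_le_pow_left hV k
  rintro _ ⟨n, b, lam, hb, hlam, rfl⟩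
  let w : Option (Fin n) → ℝ := fun c => c.elim (1 - ∑ i, |lam i|) fun i => |lam i|
  let u : Option (Fin n) → X := fun c => c.elim 0 fun i => (SignType.sign (lam i) : ℝ) • b i
  have hw0 : ∀ c, 0 ≤ w c := by
    rintro (_ | i)
    · simpa [w] using hlam
    · simp [w]
  have hw : ∑ c, w c = 1 := by simp [w, Fintype.sum_option]
  have huV : ∀ c, u c ∈ V := by
    rintro (_ | i)
    · simp [u, V]
    · have := hb i
      rw [Finset.mem_coe] at this
      rcases lt_trichotomy (lam i) 0 with h | h | h <;> simp [u, V, h, this]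
  have hVa : ∀ v ∈ V, ‖v‖ ≤ a := by
    intro v hv
    simp only [V, Finset.mem_insert, Finset.mem_union, Finset.mem_image] at hv
    rcases hv with rfl | hv | ⟨d, hd, rfl⟩
    · simpa using ha
    · exact hD _ hv
    · simpa using hD _ hd
  have hx : ∑ c, w c • u c = ∑ i, lam i • b i := by
    simp [w, u, Fintype.sum_option, smul_smul]
  obtain ⟨f, hf⟩ := hX.exists_norm_sub_sum_le (by linarith) hρ hw0 hw ha
    (fun c => hVa _ (huV c)) k
  refine ⟨_, Finset.mem_image_of_mem _ (a := fun j => u (f j))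
    (Fintype.mem_piFinset.2 fun j => huV _), ?_⟩
  rw [hx] at hf
  have hkey : ‖∑ i, lam i • b i - (k : ℝ)⁻¹ • ∑ j, u (f j)‖ ≤
      (k : ℝ)⁻¹ * (2 * (ρ * ((k : ℝ) ^ (1 / p) * a))) := by
    calc _ = ‖(k : ℝ)⁻¹ • ((k : ℝ) • ∑ i, lam i • b i - ∑ j, u (f j))‖ := by
          rw [smul_sub, smul_smul, inv_mul_cancel₀ hk'.ne', one_smul]
      _ = (k : ℝ)⁻¹ * ‖(k : ℝ) • ∑ i, lam i • b i - ∑ j, u (f j)‖ := by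
          rw [norm_smul, Real.norm_of_nonneg (by positivity)]
      _ ≤ _ := by gcongr
  refine hkey.trans ?_
  have hk2 : (k : ℝ) ^ (1 / p - 1) ≤ 2 * ((k : ℝ) + 1) ^ (1 / p - 1) := by
    have hp0 : 0 < 1 / p := by positivity
    have hp1 : 1 / p ≤ 1 := by rw [div_le_one (by linarith)]; exact hp.le
    have h1k : (1 : ℝ) ≤ k := by exact_mod_cast hk
    rw [Real.rpow_sub hk', Real.rpow_sub (by positivity), Real.rpow_one, Real.rpow_one,
      ← mul_div_assoc, div_le_div_iff₀ hk' (by positivity)]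
    have : (k : ℝ) ^ (1 / p) ≤ ((k : ℝ) + 1) ^ (1 / p) := by gcongr; linarith
    have h0 : 0 ≤ (k : ℝ) ^ (1 / p) := by positivity
    nlinarith
  have h0 : 0 ≤ a * ((k : ℝ) + 1) ^ (1 / p - 1) := by positivity
  calc (k : ℝ)⁻¹ * (2 * (ρ * ((k : ℝ) ^ (1 / p) * a)))
      = 2 * ρ * a * (k : ℝ) ^ (1 / p - 1) := by
        rw [Real.rpow_sub hk', Real.rpow_one]; field_simp
    _ ≤ 2 * ρ * a * (2 * ((k : ℝ) + 1) ^ (1 / p - 1)) := by gcongr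
    _ ≤ _ := by nlinarith

end Maurey

section Chaining

variable {X : Type*} [NormedAddCommGroup X] [NormedSpace ℝ X]

open Pointwise in
/-- Chaining along nets of cardinality `2 ^ 2 ^ l`, with `k j` samples at the `j`-th level. -/
lemma IsTypePWith.hasNet_absConvHull_chain {p ρ : ℝ} (hp : 1 < p)
    (hρ : 0 ≤ ρ) (hX : IsTypePWith X p ρ) {A : Set X} {R : ℝ} (hR : ∀ a ∈ A, ‖a‖ ≤ R)
    {β : ℕ → ℝ} (hβ0 : ∀ l, 0 ≤ β l) (hβ : Antitone β)
    (hnet : ∀ l, HasNet A (2 ^ 2 ^ l) (β l)) {Q : ℕ} (hQ : 0 < Q) (L J : ℕ) (k : ℕ → ℕ) :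
    HasNet (absConvHull A)
      ((2 * Q + 1) ^ 2 ^ 2 ^ L * ∏ j ∈ Finset.range J, (2 * 2 ^ (3 * 2 ^ (L + j)) + 1) ^ k j)
      (2 ^ 2 ^ L * ((|R| + β 0) / Q) + ∑ j ∈ Finset.range J,
        (4 * ρ + 1) * (2 * β (L + j)) * ((k j : ℝ) + 1) ^ (1 / p - 1) + β (L + J)) := by
  classical
  choose T hT hTA using hnet
  have hπ : ∀ l, ∃ π : X → X, ∀ a ∈ A, π a ∈ T l ∧ ‖a - π a‖ ≤ β l := by
    intro l
    choose! π hπ using hTA l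
    exact ⟨π, hπ⟩
  choose π hπ using hπ
  have hmain : ∀ J, HasNet (absConvHull (π (L + J) '' A))
      ((2 * Q + 1) ^ 2 ^ 2 ^ L * ∏ j ∈ Finset.range J, (2 * 2 ^ (3 * 2 ^ (L + j)) + 1) ^ k j)
      (2 ^ 2 ^ L * ((|R| + β 0) / Q) + ∑ j ∈ Finset.range J,
        (4 * ρ + 1) * (2 * β (L + j)) * ((k j : ℝ) + 1) ^ (1 / p - 1)) := by
    intro J
    induction J with
    | zero =>
      let D := (T L).filter fun x => ‖x‖ ≤ |R| + β 0
      have hD : D.card ≤ 2 ^ 2 ^ L := (Finset.card_filter_le _ _).trans (hT L)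
      have hsub : π L '' A ⊆ (D : Set X) := by
        rintro _ ⟨a, ha, rfl⟩
        refine Finset.mem_coe.2 (Finset.mem_filter.2 ⟨(hπ L a ha).1, ?_⟩)
        have h1 := norm_sub_norm_le (π L a) a
        rw [norm_sub_rev] at h1
        linarith [(hπ L a ha).2, hR a ha, le_abs_self R, hβ (Nat.zero_le L)]
      have hR0 : 0 ≤ |R| + β 0 := add_nonneg (abs_nonneg _) (hβ0 0)
      refine (HasNet.absConvHull_grid D (fun d hd => (Finset.mem_filter.1 hd).2) hQ).mono
        (absConvHull_mono hsub) ?_ ?_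
      · simpa using Nat.pow_le_pow_right (by omega) hD
      · simp only [Finset.range_zero, Finset.sum_empty, add_zero]
        gcongr
        exact_mod_cast hD
    | succ J ih =>
      set l := L + J
      let D := ((T (l + 1) ×ˢ T l).image fun x => x.1 - x.2).filter fun x => ‖x‖ ≤ 2 * β l
      have hD : D.card ≤ 2 ^ (3 * 2 ^ l) := by
        refine (Finset.card_filter_le _ _).trans (Finset.card_image_le.trans ?_)
        rw [Finset.card_product]
        refine (Nat.mul_le_mul (hT (l + 1)) (hT l)).trans (le_of_eq ?_)
        rw [← pow_add]
        congr 1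
        ring
      have hsub : (fun a => π (l + 1) a - π l a) '' A ⊆ (D : Set X) := by
        rintro _ ⟨a, ha, rfl⟩
        refine Finset.mem_coe.2 (Finset.mem_filter.2 ⟨Finset.mem_image.2
          ⟨(π (l + 1) a, π l a), Finset.mem_product.2 ⟨(hπ _ a ha).1, (hπ _ a ha).1⟩, rfl⟩, ?_⟩)
        have h1 := norm_sub_le (a - π l a) (a - π (l + 1) a)
        rw [sub_sub_sub_cancel_left] at h1
        linarith [(hπ l a ha).2, (hπ (l + 1) a ha).2, hβ (Nat.le_succ l)]
      have hM := (hX.hasNet_absConvHull hp hρ D (a := 2 * β l) (by linarith [hβ0 l])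
        (fun d hd => (Finset.mem_filter.1 hd).2) hD (k J)).mono (absConvHull_mono hsub)
        le_rfl le_rfl
      refine (ih.add hM).mono ?_ ?_ ?_
      · have := absConvHull_image_add_subset (π l) (fun a => π (l + 1) a - π l a) A
        simp only [add_sub_cancel] at this
        exact this
      · rw [Finset.prod_range_succ, mul_assoc]
      · rw [Finset.sum_range_succ, add_assoc]
  have hlast : HasNet (absConvHull ((fun a => a - π (L + J) a) '' A)) 1 (β (L + J)) := by
    refine HasNet.of_norm_le (norm_le_of_mem_absConvHull (hβ0 _) ?_)
    rintro _ ⟨a, ha, rfl⟩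
    exact (hπ _ a ha).2
  refine ((hmain J).add hlast).mono ?_ (by rw [mul_one]) le_rfl
  have := absConvHull_image_add_subset (π (L + J)) (fun a => a - π (L + J) a) A
  simpa only [add_sub_cancel, Set.image_id'] using this

lemma sum_range_two_rpow_neg_le {η : ℝ} (hη : 0 < η) (J : ℕ) :
    ∑ j ∈ Finset.range J, (2 : ℝ) ^ (-(η * j)) ≤ (1 - 2 ^ (-η))⁻¹ := by
  have h1 : (2 : ℝ) ^ (-η) < 1 := Real.rpow_lt_one_of_one_lt_of_neg one_lt_two (by linarith)
  have : ∀ j : ℕ, (2 : ℝ) ^ (-(η * j)) = ((2 : ℝ) ^ (-η)) ^ j := fun j => by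
    rw [← Real.rpow_natCast, ← Real.rpow_mul zero_le_two, neg_mul]
  simp only [this]
  exact ((summable_geometric_of_lt_one (by positivity) h1).sum_le_tsum _
    fun _ _ => by positivity).trans_eq (tsum_geometric_of_lt_one (by positivity) h1)

lemma head_bits_le {N L : ℕ} (h : 2 * 2 ^ L ≤ N) :
    (2 * N + 2) * 2 ^ 2 ^ L ≤ 4 * 2 ^ N := by
  obtain ⟨m, rfl⟩ : ∃ m, N = 2 ^ L + m := ⟨N - 2 ^ L, by omega⟩
  have h1 : m < 2 ^ m := Nat.lt_two_pow_self
  have h2 : 2 * (2 ^ L + m) + 2 ≤ 4 * 2 ^ m := by omega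
  calc _ ≤ 4 * 2 ^ m * 2 ^ 2 ^ L := Nat.mul_le_mul_right _ h2
    _ = _ := by rw [pow_add]; ring

/-- The entropy numbers of the absolutely convex hull in terms of those of the set. -/
lemma IsTypePWith.exists_dyadEntropyNum_absConvHull_le {p ρ η : ℝ} (hp : 1 < p)
    (hρ : 0 ≤ ρ) (hX : IsTypePWith X p ρ) {A : Set X} {R : ℝ} (hR : ∀ a ∈ A, ‖a‖ ≤ R)
    {β : ℕ → ℝ} (hβ0 : ∀ l, 0 ≤ β l) (hβ : Antitone β)
    (hnet : ∀ l, HasNet A (2 ^ 2 ^ l) (β l)) (hη : 0 < η) :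
    ∃ c : ℕ, ∃ C : ℝ, 0 ≤ C ∧ ∀ N L : ℕ, 2 * 2 ^ L ≤ N →
      dyadEntropyNum (absConvHull A) (2 ^ (N + c)) ≤ C * (2 ^ (-(N : ℝ)) +
        ∑ j ∈ Finset.range (N + 1),
          β (L + j) * 2 ^ ((1 - 1 / p) * ((L + j : ℕ) + η * j - N))) := by
  set G : ℝ := (1 - 2 ^ (-η))⁻¹
  obtain ⟨c, hc⟩ := pow_unbounded_of_one_lt (5 + 5 * G) (one_lt_two (α := ℝ))
  have hR0 : 0 ≤ |R| + β 0 := add_nonneg (abs_nonneg _) (hβ0 0)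
  refine ⟨c, (|R| + β 0) + (8 * ρ + 3), by positivity, fun N L hNL => ?_⟩
  set θ := 1 - 1 / p with hθ
  have hθ0 : 0 < θ := by rw [hθ, sub_pos, div_lt_one (by linarith)]; exact hp
  set y : ℕ → ℝ := fun j => 2 ^ ((N : ℝ) - (L + j : ℕ) - η * j) with hy
  have hy0 : ∀ j, 0 < y j := fun j => by positivity
  set S := ∑ j ∈ Finset.range (N + 1), β (L + j) * (2 : ℝ) ^ (θ * ((L + j : ℕ) + η * j - N))
    with hS
  have hS0 : 0 ≤ S := Finset.sum_nonneg fun j _ => mul_nonneg (hβ0 _) (by positivity)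
  have hchain := hX.hasNet_absConvHull_chain hp hρ hR hβ0 hβ hnet (Q := 2 ^ (2 * N))
    (by positivity) L (N + 1) fun j => ⌊y j⌋₊
  have hlast : β (L + (N + 1)) ≤ S := by
    have h1 : β (L + N) * (2 : ℝ) ^ (θ * ((L + N : ℕ) + η * N - N)) ≤ S :=
      Finset.single_le_sum (f := fun j : ℕ =>
        β (L + j) * (2 : ℝ) ^ (θ * ((L + j : ℕ) + η * j - N)))
        (fun j _ => mul_nonneg (hβ0 _) (by positivity)) (Finset.self_mem_range_succ N)
    have h2 : (1 : ℝ) ≤ (2 : ℝ) ^ (θ * ((L + N : ℕ) + η * N - N)) := by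
      refine Real.one_le_rpow one_le_two (mul_nonneg hθ0.le ?_)
      push_cast
      have : 0 ≤ η * N := by positivity
      have : (0 : ℝ) ≤ L := by positivity
      linarith
    have h3 := le_mul_of_one_le_right (hβ0 (L + N)) h2
    have h4 : β (L + (N + 1)) ≤ β (L + N) := hβ (by omega)
    linarith
  have hsum : ∑ j ∈ Finset.range (N + 1),
      (4 * ρ + 1) * (2 * β (L + j)) * ((⌊y j⌋₊ : ℝ) + 1) ^ (1 / p - 1) ≤ (8 * ρ + 2) * S := by
    rw [hS, Finset.mul_sum]
    refine Finset.sum_le_sum fun j _ => ?_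
    have h1 : ((⌊y j⌋₊ : ℝ) + 1) ^ (1 / p - 1) ≤ 2 ^ (θ * ((L + j : ℕ) + η * j - N)) := by
      calc ((⌊y j⌋₊ : ℝ) + 1) ^ (1 / p - 1) ≤ (y j) ^ (1 / p - 1) :=
            Real.rpow_le_rpow_of_nonpos (hy0 j) (Nat.lt_floor_add_one _).le (by linarith)
        _ = _ := by
            rw [hy, ← Real.rpow_mul zero_le_two, hθ]
            congr 1
            ring
    have h0 : 0 ≤ (4 * ρ + 1) * (2 * β (L + j)) :=
      mul_nonneg (by linarith) (by linarith [hβ0 (L + j)])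
    calc _ ≤ (4 * ρ + 1) * (2 * β (L + j)) * 2 ^ (θ * ((L + j : ℕ) + η * j - N)) := by gcongr
      _ = _ := by ring
  have hhead : (2 : ℝ) ^ 2 ^ L * ((|R| + β 0) / (2 ^ (2 * N) : ℕ)) ≤
      (|R| + β 0) * 2 ^ (-(N : ℝ)) := by
    rw [Real.rpow_neg zero_le_two, Real.rpow_natCast]
    push_cast
    have h2 : (2 : ℝ) ^ 2 ^ L ≤ 2 ^ N := pow_le_pow_right₀ one_le_two (by omega)
    calc (2 : ℝ) ^ 2 ^ L * ((|R| + β 0) / 2 ^ (2 * N)) ≤ 2 ^ N * ((|R| + β 0) / 2 ^ (2 * N)) := by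
          gcongr
      _ = _ := by rw [two_mul, pow_add]; field_simp
  refine (hchain.mono subset_rfl (m' := 2 ^ (2 ^ (N + c) - 1)) ?_ ?_).entropyNum_le (by positivity)
  · have hprod : ∏ j ∈ Finset.range (N + 1), (2 * 2 ^ (3 * 2 ^ (L + j)) + 1) ^ ⌊y j⌋₊ ≤
        2 ^ ∑ j ∈ Finset.range (N + 1), 5 * 2 ^ (L + j) * ⌊y j⌋₊ := by
      rw [← Finset.prod_pow_eq_pow_sum]
      refine Finset.prod_le_prod' fun j _ => ?_
      rw [pow_mul 2 (5 * 2 ^ (L + j))]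
      refine Nat.pow_le_pow_left ?_ _
      have h1 : 3 * 2 ^ (L + j) + 2 ≤ 5 * 2 ^ (L + j) := by
        have : 0 < 2 ^ (L + j) := by positivity
        omega
      refine le_trans ?_ (Nat.pow_le_pow_right two_pos h1)
      rw [pow_add 2 (3 * 2 ^ (L + j)) 2]
      have : 0 < 2 ^ (3 * 2 ^ (L + j)) := by positivity
      linarith
    have hgrid : (2 * 2 ^ (2 * N) + 1) ^ 2 ^ 2 ^ L ≤ 2 ^ (4 * 2 ^ N) := by
      refine le_trans ?_ (Nat.pow_le_pow_right two_pos (head_bits_le hNL))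
      rw [pow_mul 2 (2 * N + 2)]
      refine Nat.pow_le_pow_left ?_ _
      rw [pow_add]
      have : 0 < 2 ^ (2 * N) := by positivity
      omega
    refine (Nat.mul_le_mul hgrid hprod).trans ?_
    rw [← pow_add]
    refine Nat.pow_le_pow_right two_pos (Nat.le_sub_one_of_lt ?_)
    have hreal : (4 * 2 ^ N + ∑ j ∈ Finset.range (N + 1), 5 * 2 ^ (L + j) * (⌊y j⌋₊ : ℝ)) <
        2 ^ (N + c) := by
      have h1 : ∑ j ∈ Finset.range (N + 1), 5 * 2 ^ (L + j) * (⌊y j⌋₊ : ℝ) ≤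
          ∑ j ∈ Finset.range (N + 1), 5 * 2 ^ N * (2 : ℝ) ^ (-(η * j)) := by
        refine Finset.sum_le_sum fun j _ => ?_
        calc 5 * 2 ^ (L + j) * (⌊y j⌋₊ : ℝ) ≤ 5 * 2 ^ (L + j) * y j := by
              gcongr
              exact Nat.floor_le (hy0 j).le
          _ = _ := by
              rw [hy, mul_assoc, mul_assoc, ← Real.rpow_natCast, ← Real.rpow_natCast 2 N,
                ← Real.rpow_add two_pos, ← Real.rpow_add two_pos]
              congr 2
              ring
      rw [← Finset.mul_sum] at h1
      have h2 := sum_range_two_rpow_neg_le hη (N + 1)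
      have hN : (0 : ℝ) < 2 ^ N := by positivity
      rw [pow_add]
      nlinarith [mul_le_mul_of_nonneg_left h2 hN.le, mul_lt_mul_of_pos_left hc hN]
    exact_mod_cast hreal
  · have h2N : (0 : ℝ) ≤ 2 ^ (-(N : ℝ)) := by positivity
    nlinarith [mul_nonneg hR0 hS0, mul_nonneg hρ h2N]

end Chaining

section Sequences

lemma sum_range_two_pow_log (g : ℕ → ℝ) (K : ℕ) :
    ∑ n ∈ Finset.range (2 ^ K - 1), g (Nat.log 2 (n + 1)) / 2 ^ Nat.log 2 (n + 1) =
      ∑ l ∈ Finset.range K, g l := by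
  induction K with
  | zero => simp
  | succ K ih =>
    have hpos : 0 < 2 ^ K := by positivity
    have h : 2 ^ (K + 1) - 1 = (2 ^ K - 1) + 2 ^ K := by rw [pow_succ]; omega
    rw [h, Finset.sum_range_add, ih, Finset.sum_range_succ]
    congr 1
    have hlog : ∀ x ∈ Finset.range (2 ^ K), Nat.log 2 (2 ^ K - 1 + x + 1) = K := by
      intro x hx
      have hx := Finset.mem_range.1 hx
      refine Nat.log_eq_of_pow_le_of_lt_pow (by omega) ?_
      rw [pow_succ]
      omega
    rw [Finset.sum_congr rfl fun x hx => by rw [hlog x hx], Finset.sum_const, Finset.card_range,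
      nsmul_eq_mul]
    push_cast
    field_simp

/-- Condensation along the dyadic blocks. -/
lemma summable_comp_log_iff {g : ℕ → ℝ} (hg : ∀ l, 0 ≤ g l) :
    Summable (fun n : ℕ => g (Nat.log 2 (n + 1)) / 2 ^ Nat.log 2 (n + 1)) ↔ Summable g := by
  have h0 : ∀ n : ℕ, 0 ≤ g (Nat.log 2 (n + 1)) / 2 ^ Nat.log 2 (n + 1) :=
    fun n => div_nonneg (hg _) (by positivity)
  constructor
  · intro h
    refine summable_of_sum_range_le hg
      (c := ∑' n : ℕ, g (Nat.log 2 (n + 1)) / 2 ^ Nat.log 2 (n + 1)) fun K => ?_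
    rw [← sum_range_two_pow_log]
    exact h.sum_le_tsum _ fun n _ => h0 n
  · intro h
    refine summable_of_sum_range_le h0 (c := ∑' l, g l) fun n => ?_
    have hn : n ≤ 2 ^ n - 1 := Nat.le_sub_one_of_lt Nat.lt_two_pow_self
    refine (Finset.sum_le_sum_of_subset_of_nonneg (Finset.range_subset_range.2 hn)
      fun _ _ _ => h0 _).trans ?_
    rw [sum_range_two_pow_log]
    exact h.sum_le_tsum _ fun n _ => hg n

lemma add_rpow_le_two_rpow_mul {x y s : ℝ} (hx : 0 ≤ x) (hy : 0 ≤ y) (hs : 0 < s) :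
    (x + y) ^ s ≤ 2 ^ s * (x ^ s + y ^ s) := by
  have hxs := Real.rpow_nonneg hx s
  have hys := Real.rpow_nonneg hy s
  have h2 : (0 : ℝ) ≤ 2 ^ s := by positivity
  rcases le_total x y with h | h
  · calc (x + y) ^ s ≤ (2 * y) ^ s := by gcongr; linarith
      _ = 2 ^ s * y ^ s := Real.mul_rpow zero_le_two hy
      _ ≤ _ := by gcongr; linarith
  · calc (x + y) ^ s ≤ (2 * x) ^ s := by gcongr; linarith
      _ = 2 ^ s * x ^ s := Real.mul_rpow zero_le_two hx
      _ ≤ _ := by gcongr; linarith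

lemma rpow_sum_geometric_le {κ s : ℝ} (hκ : 0 < κ) (hs : 0 < s) {b : ℕ → ℝ}
    (hb : ∀ j, 0 ≤ b j) (n : ℕ) :
    (∑ j ∈ Finset.range n, (2 : ℝ) ^ (-(2 * κ * j)) * b j) ^ s ≤
      ((1 - 2 ^ (-κ))⁻¹) ^ s * ∑ j ∈ Finset.range n, ((2 : ℝ) ^ (-(κ * s))) ^ j * b j ^ s := by
  have hterm : ∀ j : ℕ, ((2 : ℝ) ^ (-(κ * j)) * b j) ^ s =
      ((2 : ℝ) ^ (-(κ * s))) ^ j * b j ^ s := by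
    intro j
    rw [Real.mul_rpow (by positivity) (hb j), ← Real.rpow_mul zero_le_two, ← Real.rpow_natCast,
      ← Real.rpow_mul zero_le_two]
    congr 2
    ring
  set T := ∑ j ∈ Finset.range n, ((2 : ℝ) ^ (-(κ * s))) ^ j * b j ^ s
  have h0 : ∀ j, 0 ≤ ((2 : ℝ) ^ (-(κ * s))) ^ j * b j ^ s := fun j =>
    mul_nonneg (by positivity) (Real.rpow_nonneg (hb j) s)
  have hT0 : 0 ≤ T := Finset.sum_nonneg fun j _ => h0 j
  have hle : ∀ j ∈ Finset.range n, (2 : ℝ) ^ (-(κ * j)) * b j ≤ T ^ s⁻¹ := by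
    intro j hj
    rw [Real.le_rpow_inv_iff_of_pos (mul_nonneg (by positivity) (hb j)) hT0 hs, hterm]
    exact Finset.single_le_sum (fun j _ => h0 j) hj
  have hG : 0 ≤ (1 - (2 : ℝ) ^ (-κ))⁻¹ :=
    (Finset.sum_nonneg fun _ _ => by positivity).trans (sum_range_two_rpow_neg_le hκ 0)
  calc (∑ j ∈ Finset.range n, (2 : ℝ) ^ (-(2 * κ * j)) * b j) ^ s
      ≤ ((1 - (2 : ℝ) ^ (-κ))⁻¹ * T ^ s⁻¹) ^ s := by
        refine Real.rpow_le_rpow (Finset.sum_nonneg fun j _ => mul_nonneg (by positivity) (hb j))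
          ?_ hs.le
        calc ∑ j ∈ Finset.range n, (2 : ℝ) ^ (-(2 * κ * j)) * b j
            ≤ ∑ j ∈ Finset.range n, (2 : ℝ) ^ (-(κ * j)) * T ^ s⁻¹ := by
              refine Finset.sum_le_sum fun j hj => ?_
              rw [show -(2 * κ * j) = -(κ * j) + -(κ * j) by ring, Real.rpow_add two_pos, mul_assoc]
              exact mul_le_mul_of_nonneg_left (hle j hj) (by positivity)
          _ ≤ _ := by
              rw [← Finset.sum_mul]
              exact mul_le_mul_of_nonneg_right (sum_range_two_rpow_neg_le hκ n) (by positivity)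
    _ = _ := by
        rw [Real.mul_rpow hG (by positivity), ← Real.rpow_mul hT0, inv_mul_cancel₀ hs.ne',
          Real.rpow_one]

lemma summable_geometric_mul_shift {q : ℝ} (hq0 : 0 ≤ q) (hq1 : q < 1) {c : ℕ → ℝ}
    (hc0 : ∀ l, 0 ≤ c l) (hc : Summable c) (L : ℕ) : Summable fun j => q ^ j * c (L + j) := by
  refine Summable.of_nonneg_of_le (fun j => mul_nonneg (pow_nonneg hq0 j) (hc0 _)) (fun j => ?_)
    ((summable_nat_add_iff L).2 hc)
  rw [add_comm]
  exact mul_le_of_le_one_left (hc0 _) (pow_le_one₀ hq0 hq1.le)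

lemma summable_tsum_geometric_mul_shift {q : ℝ} (hq0 : 0 ≤ q) (hq1 : q < 1) {c : ℕ → ℝ}
    (hc0 : ∀ l, 0 ≤ c l) (hc : Summable c) : Summable fun L => ∑' j, q ^ j * c (L + j) := by
  have hshift : ∀ j, Summable fun L => c (L + j) := fun j => (summable_nat_add_iff j).2 hc
  have hrow : ∀ j, Summable fun L => q ^ j * c (L + j) := fun j => (hshift j).mul_left _
  have hcol : Summable fun j => ∑' L, q ^ j * c (L + j) := by
    refine Summable.of_nonneg_of_le
      (fun j => tsum_nonneg fun L => mul_nonneg (pow_nonneg hq0 _) (hc0 _)) (fun j => ?_)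
      ((summable_geometric_of_lt_one hq0 hq1).mul_right (∑' l, c l))
    simp only [tsum_mul_left]
    refine mul_le_mul_of_nonneg_left ?_ (pow_nonneg hq0 j)
    have := hc.sum_add_tsum_nat_add j
    linarith [Finset.sum_nonneg fun l (_ : l ∈ Finset.range j) => hc0 l]
  have h : Summable fun x : ℕ × ℕ => q ^ x.1 * c (x.2 + x.1) :=
    (summable_prod_of_nonneg fun x => mul_nonneg (pow_nonneg hq0 _) (hc0 _)).2 ⟨hrow, hcol⟩
  exact h.prod_symm.prod

lemma summable_rpow_mul_two_rpow_neg (a : ℝ) {b : ℝ} (hb : 0 < b) :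
    Summable fun N : ℕ => (N : ℝ) ^ a * 2 ^ (-(b * N)) := by
  have hq : ‖(2 : ℝ) ^ (-b)‖ < 1 := by
    rw [Real.norm_of_nonneg (by positivity)]
    exact Real.rpow_lt_one_of_one_lt_of_neg one_lt_two (by linarith)
  refine (summable_pow_mul_geometric_of_norm_lt_one ⌈a⌉₊ hq).of_norm_bounded_eventually_nat ?_
  filter_upwards [Filter.eventually_ge_atTop 1] with N hN
  have hN' : (1 : ℝ) ≤ N := by exact_mod_cast hN
  rw [Real.norm_of_nonneg (by positivity), ← Real.rpow_natCast, ← Real.rpow_natCast,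
    ← Real.rpow_mul zero_le_two, neg_mul]
  gcongr
  exact Nat.le_ceil a

lemma rpow_le_of_dyadic_bound {θ δ s η C : ℝ} {c : ℕ} (hδ : 0 < δ)
    (hs : 0 < s) (hη : η * θ = δ / 2) (hC : 0 ≤ C) {E β : ℕ → ℝ} (hE0 : ∀ n, 0 ≤ E n)
    (hβ0 : ∀ l, 0 ≤ β l)
    (hβ : Summable fun l : ℕ => ((2 : ℝ) ^ ((θ + δ) * l) * β l) ^ s) {N L : ℕ}
    (hLN : (N : ℝ) ≤ 4 * 2 ^ L)
    (hbound : E (2 ^ (N + c)) ≤ C * (2 ^ (-(N : ℝ)) +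
      ∑ j ∈ Finset.range (N + 1), β (L + j) * 2 ^ (θ * ((L + j : ℕ) + η * j - N)))) :
    ((N : ℝ) ^ δ * 2 ^ (θ * N) * E (2 ^ (N + c))) ^ s ≤
      C ^ s * 2 ^ s * (((N : ℝ) ^ (s * δ) * 2 ^ (-((1 - θ) * s * N))) +
        ((4 : ℝ) ^ δ) ^ s * ((1 - 2 ^ (-(δ / 4)))⁻¹) ^ s *
          ∑' j : ℕ, ((2 : ℝ) ^ (-(δ / 4 * s))) ^ j *
            ((2 : ℝ) ^ ((θ + δ) * (L + j : ℕ)) * β (L + j)) ^ s) := by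
  set b : ℕ → ℝ := fun l => (2 : ℝ) ^ ((θ + δ) * l) * β l with hb
  have hb0 : ∀ l, 0 ≤ b l := fun l => mul_nonneg (by positivity) (hβ0 l)
  have hbs0 : ∀ l, 0 ≤ b l ^ s := fun l => Real.rpow_nonneg (hb0 l) s
  set κ := δ / 4 with hκ
  have hκ0 : 0 < κ := by positivity
  set q : ℝ := (2 : ℝ) ^ (-(κ * s))
  have hq0 : 0 ≤ q := by positivity
  have hq1 : q < 1 := Real.rpow_lt_one_of_one_lt_of_neg one_lt_two (by nlinarith)
  set S : ℝ := ∑' j, q ^ j * b (L + j) ^ s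
  set G : ℝ := (1 - 2 ^ (-κ))⁻¹
  have hG0 : 0 ≤ G :=
    (Finset.sum_nonneg fun _ _ => by positivity).trans (sum_range_two_rpow_neg_le hκ0 0)
  set U := ∑ j ∈ Finset.range (N + 1), (2 : ℝ) ^ (-(2 * κ * j)) * b (L + j) with hU
  have hU0 : 0 ≤ U := Finset.sum_nonneg fun j _ => mul_nonneg (by positivity) (hb0 _)
  have h1 : (N : ℝ) ^ δ * 2 ^ (θ * N) * E (2 ^ (N + c)) ≤
      C * ((N : ℝ) ^ δ * 2 ^ (-((1 - θ) * N)) + (4 : ℝ) ^ δ * U) := by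
    have hNδ : (N : ℝ) ^ δ ≤ 4 ^ δ * 2 ^ (δ * L) := by
      calc (N : ℝ) ^ δ ≤ (4 * 2 ^ L) ^ δ := by gcongr
        _ = _ := by
          rw [Real.mul_rpow (by norm_num) (by positivity), ← Real.rpow_natCast,
            ← Real.rpow_mul zero_le_two, mul_comm δ]
    have hUeq : 2 ^ (δ * L) * (2 ^ (θ * N) * ∑ j ∈ Finset.range (N + 1),
        β (L + j) * 2 ^ (θ * ((L + j : ℕ) + η * j - N))) = U := by
      rw [hU, Finset.mul_sum, Finset.mul_sum]
      refine Finset.sum_congr rfl fun j _ => ?_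
      rw [hb]
      calc _ = ((2 : ℝ) ^ (δ * L) * 2 ^ (θ * N) * 2 ^ (θ * ((L + j : ℕ) + η * j - N))) *
            β (L + j) := by ring
        _ = (2 ^ (-(2 * κ * j)) * 2 ^ ((θ + δ) * (L + j : ℕ))) * β (L + j) := by
            rw [← Real.rpow_add two_pos, ← Real.rpow_add two_pos, ← Real.rpow_add two_pos]
            congr 2
            push_cast
            rw [hκ]
            linear_combination (j : ℝ) * hη
        _ = _ := by ring
    have hsum0 : 0 ≤ ∑ j ∈ Finset.range (N + 1),
        β (L + j) * (2 : ℝ) ^ (θ * ((L + j : ℕ) + η * j - N)) :=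
      Finset.sum_nonneg fun j _ => mul_nonneg (hβ0 _) (by positivity)
    calc (N : ℝ) ^ δ * 2 ^ (θ * N) * E (2 ^ (N + c))
        ≤ (N : ℝ) ^ δ * 2 ^ (θ * N) * (C * (2 ^ (-(N : ℝ)) + ∑ j ∈ Finset.range (N + 1),
          β (L + j) * 2 ^ (θ * ((L + j : ℕ) + η * j - N)))) := by
          gcongr
      _ = C * ((N : ℝ) ^ δ * (2 ^ (θ * N) * 2 ^ (-(N : ℝ))) +
          (N : ℝ) ^ δ * (2 ^ (θ * N) * ∑ j ∈ Finset.range (N + 1),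
            β (L + j) * 2 ^ (θ * ((L + j : ℕ) + η * j - N)))) := by ring
      _ ≤ C * ((N : ℝ) ^ δ * (2 ^ (θ * N) * 2 ^ (-(N : ℝ))) +
          4 ^ δ * 2 ^ (δ * L) * (2 ^ (θ * N) * ∑ j ∈ Finset.range (N + 1),
            β (L + j) * 2 ^ (θ * ((L + j : ℕ) + η * j - N)))) := by gcongr
      _ = _ := by
          rw [mul_assoc (4 ^ δ), hUeq, ← Real.rpow_add two_pos]
          ring_nf
  have hUs : U ^ s ≤ G ^ s * S := by
    refine (rpow_sum_geometric_le hκ0 hs (fun j => hb0 (L + j)) (N + 1)).trans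
      (mul_le_mul_of_nonneg_left ?_ (by positivity))
    exact (summable_geometric_mul_shift hq0 hq1 hbs0 hβ L).sum_le_tsum _
      fun j _ => mul_nonneg (pow_nonneg hq0 j) (hbs0 _)
  have h4 : (0 : ℝ) ≤ 4 ^ δ := by positivity
  calc _ ≤ (C * ((N : ℝ) ^ δ * 2 ^ (-((1 - θ) * N)) + (4 : ℝ) ^ δ * U)) ^ s := by
        have := hE0 (2 ^ (N + c))
        gcongr
    _ ≤ C ^ s * (2 ^ s * (((N : ℝ) ^ δ * 2 ^ (-((1 - θ) * N))) ^ s + (4 ^ δ * U) ^ s)) := by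
        rw [Real.mul_rpow hC (by positivity)]
        gcongr
        exact add_rpow_le_two_rpow_mul (by positivity) (by positivity) hs
    _ = C ^ s * 2 ^ s * (((N : ℝ) ^ (s * δ) * 2 ^ (-((1 - θ) * s * N))) +
        (4 ^ δ) ^ s * U ^ s) := by
        rw [Real.mul_rpow h4 hU0, Real.mul_rpow (by positivity) (by positivity),
          ← Real.rpow_mul (Nat.cast_nonneg N), ← Real.rpow_mul zero_le_two, mul_comm s δ]
        ring_nf
    _ ≤ _ := by
        rw [mul_assoc ((4 ^ δ) ^ s)]
        gcongr

lemma summable_inv_mul_of_le_add_log {a b D D' : ℝ} (hb : 0 < b) (hD : 0 ≤ D) (hD' : 0 ≤ D')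
    {S V : ℕ → ℝ} (hS0 : ∀ L, 0 ≤ S L) (hS : Summable S) (hV0 : ∀ N, 0 ≤ V N)
    (hV : ∀ N L : ℕ, Nat.log 2 N = L + 1 →
      V N ≤ D * ((N : ℝ) ^ a * 2 ^ (-(b * N)) + D' * S L)) :
    Summable fun N : ℕ => (N : ℝ)⁻¹ * V N := by
  have hSlog : Summable fun N : ℕ => S (Nat.log 2 N - 1) / 2 ^ Nat.log 2 N := by
    rw [← summable_nat_add_iff 1]
    refine (summable_comp_log_iff (g := fun i => S (i - 1)) fun i => hS0 _).2 ?_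
    rw [← summable_nat_add_iff 1]
    simpa using hS
  have hmaj : Summable fun N : ℕ => D * ((N : ℝ) ^ a * 2 ^ (-(b * N)) +
      D' * (S (Nat.log 2 N - 1) / 2 ^ Nat.log 2 N)) :=
    ((summable_rpow_mul_two_rpow_neg a hb).add (hSlog.mul_left _)).mul_left _
  refine hmaj.of_norm_bounded_eventually_nat ?_
  filter_upwards [Filter.eventually_ge_atTop 2] with N hN
  rw [Real.norm_of_nonneg (mul_nonneg (by positivity) (hV0 N))]
  obtain ⟨L, hL⟩ : ∃ L, Nat.log 2 N = L + 1 :=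
    ⟨Nat.log 2 N - 1, by have := Nat.log_pos one_lt_two hN; omega⟩
  have hN1 : (1 : ℝ) ≤ N := by exact_mod_cast (by omega : 1 ≤ N)
  have hNL : (2 : ℝ) ^ (L + 1) ≤ N := by
    exact_mod_cast hL ▸ Nat.pow_log_le_self 2 (by omega : N ≠ 0)
  have hSL := hS0 L
  rw [hL, Nat.add_sub_cancel]
  calc (N : ℝ)⁻¹ * V N ≤ (N : ℝ)⁻¹ * (D * ((N : ℝ) ^ a * 2 ^ (-(b * N)) + D' * S L)) :=
        mul_le_mul_of_nonneg_left (hV N L hL) (by positivity)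
    _ = D * ((N : ℝ)⁻¹ * ((N : ℝ) ^ a * 2 ^ (-(b * N))) + D' * (S L / N)) := by ring
    _ ≤ D * ((N : ℝ) ^ a * 2 ^ (-(b * N)) + D' * (S L / 2 ^ (L + 1))) := by
        have h0 : (0 : ℝ) ≤ (N : ℝ) ^ a * 2 ^ (-(b * N)) := by positivity
        have h1 := mul_le_of_le_one_left h0 (inv_le_one_of_one_le₀ hN1)
        gcongr

lemma summable_inv_mul_rpow_of_dyadic_bound {θ δ s η C : ℝ} {c : ℕ} (hθ1 : θ < 1) (hδ : 0 < δ)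
    (hs : 0 < s) (hη : η * θ = δ / 2) (hC : 0 ≤ C) {E β : ℕ → ℝ} (hE0 : ∀ n, 0 ≤ E n)
    (hβ0 : ∀ l, 0 ≤ β l)
    (hβ : Summable fun l : ℕ => ((2 : ℝ) ^ ((θ + δ) * l) * β l) ^ s)
    (hbound : ∀ N L : ℕ, 2 * 2 ^ L ≤ N → E (2 ^ (N + c)) ≤ C * (2 ^ (-(N : ℝ)) +
      ∑ j ∈ Finset.range (N + 1), β (L + j) * 2 ^ (θ * ((L + j : ℕ) + η * j - N)))) :
    Summable fun N : ℕ =>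
      (N : ℝ)⁻¹ * ((N : ℝ) ^ δ * 2 ^ (θ * N) * E (2 ^ (N + c))) ^ s := by
  have hbs0 : ∀ l : ℕ, 0 ≤ ((2 : ℝ) ^ ((θ + δ) * l) * β l) ^ s := fun l =>
    Real.rpow_nonneg (mul_nonneg (by positivity) (hβ0 l)) s
  have hq : (2 : ℝ) ^ (-(δ / 4 * s)) < 1 := Real.rpow_lt_one_of_one_lt_of_neg one_lt_two
    (by have : 0 < δ / 4 * s := by positivity
        linarith)
  have hG0 : 0 ≤ (1 - (2 : ℝ) ^ (-(δ / 4)))⁻¹ :=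
    (Finset.sum_nonneg fun _ _ => by positivity).trans
      (sum_range_two_rpow_neg_le (by positivity : 0 < δ / 4) 0)
  refine summable_inv_mul_of_le_add_log (a := s * δ) (D := C ^ s * 2 ^ s)
    (D' := ((4 : ℝ) ^ δ) ^ s * ((1 - (2 : ℝ) ^ (-(δ / 4)))⁻¹) ^ s)
    (mul_pos (by linarith) hs : 0 < (1 - θ) * s)
    (by positivity) (mul_nonneg (by positivity) (Real.rpow_nonneg hG0 s))
    (fun L => tsum_nonneg fun j => mul_nonneg (by positivity) (hbs0 (L + j)))
    (summable_tsum_geometric_mul_shift (by positivity) hq hbs0 hβ)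
    (fun N => Real.rpow_nonneg (mul_nonneg (by positivity) (hE0 _)) s) fun N L hL => ?_
  have hN : N ≠ 0 := by
    rintro rfl
    simp at hL
  have hNL : 2 ^ (L + 1) ≤ N := hL ▸ Nat.pow_log_le_self 2 hN
  have hLN : N < 2 ^ (L + 1 + 1) := hL ▸ Nat.lt_pow_succ_log_self one_lt_two N
  have hLN' : (N : ℝ) ≤ 4 * 2 ^ L := by
    have : (N : ℝ) ≤ 2 ^ (L + 1 + 1) := by exact_mod_cast hLN.le
    rw [pow_succ, pow_succ] at this
    linarith
  exact rpow_le_of_dyadic_bound hδ hs hη hC hE0 hβ0 hβ hLN'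
    (hbound N L (by rw [pow_succ] at hNL; omega))

/-- Lorentz summability is determined by the values at the powers of two. -/
lemma summable_lorentz_of_summable_dyadic {θ δ s : ℝ} {c : ℕ} (hθ0 : 0 < θ) (hδ : 0 < δ)
    (hs : 0 < s) {E : ℕ → ℝ} (hE0 : ∀ n, 0 ≤ E n) (hE : Antitone E)
    (h : Summable fun N : ℕ =>
      (N : ℝ)⁻¹ * ((N : ℝ) ^ δ * 2 ^ (θ * N) * E (2 ^ (N + c))) ^ s) :
    Summable fun n : ℕ =>
      Real.logb 2 ((n : ℝ) + 2) ^ (s * δ - 1) * ((n : ℝ) + 1) ^ (s * θ - 1) * E (n + 1) ^ s := by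
  set g : ℕ → ℝ := fun K => ((K - c : ℕ) : ℝ)⁻¹ *
    (((K - c : ℕ) : ℝ) ^ δ * 2 ^ (θ * (K - c : ℕ)) * E (2 ^ K)) ^ s with hg
  have hg0 : ∀ K, 0 ≤ g K := fun K => by
    have := hE0 (2 ^ K)
    positivity
  have hgsum : Summable g := by
    rw [← summable_nat_add_iff c]
    simpa only [hg, Nat.add_sub_cancel] using h
  have hcond := (summable_comp_log_iff hg0).2 hgsum
  refine (hcond.mul_left (((c : ℝ) + 2) ^ (s * δ) *
    ((2 : ℝ) ^ (c + 1)) ^ (s * θ))).of_norm_bounded_eventually_nat ?_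
  filter_upwards [Filter.eventually_ge_atTop (2 ^ (c + 2))] with n hn
  set K := Nat.log 2 (n + 1)
  have hKn : 2 ^ K ≤ n + 1 := Nat.pow_log_le_self 2 (by omega)
  have hnK : n + 1 < 2 ^ (K + 1) := Nat.lt_pow_succ_log_self one_lt_two _
  have hcK : c + 2 ≤ K := Nat.le_log_of_pow_le one_lt_two (by omega)
  obtain ⟨N, hN⟩ : ∃ N, K = N + c := ⟨K - c, by omega⟩
  have hN2 : (2 : ℝ) ≤ N := by exact_mod_cast (by omega : 2 ≤ N)
  set x := Real.logb 2 ((n : ℝ) + 2)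
  have hKx : (K : ℝ) ≤ x := by
    rw [Real.le_logb_iff_rpow_le one_lt_two (by positivity), Real.rpow_natCast]
    have : (2 : ℝ) ^ K ≤ n + 1 := by exact_mod_cast hKn
    linarith
  have hxK : x ≤ K + 1 := by
    rw [Real.logb_le_iff_le_rpow one_lt_two (by positivity)]
    have : ((n : ℝ) + 2) ≤ 2 ^ (K + 1) := by exact_mod_cast hnK
    exact_mod_cast this
  have hKN : (K : ℝ) = N + c := by exact_mod_cast hN
  have hc0 : (0 : ℝ) ≤ c := Nat.cast_nonneg c
  have hx0 : 0 < x := by linarith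
  have hx1 : x ^ (s * δ - 1) ≤ ((c : ℝ) + 2) ^ (s * δ) * (N : ℝ) ^ (s * δ) * (N : ℝ)⁻¹ := by
    rw [Real.rpow_sub hx0, Real.rpow_one, div_eq_mul_inv,
      ← Real.mul_rpow (by positivity) (by positivity)]
    gcongr
    · nlinarith
    · linarith
  have hm1 : ((n : ℝ) + 1) ^ (s * θ - 1) ≤
      ((2 : ℝ) ^ (c + 1)) ^ (s * θ) * 2 ^ (θ * N * s) * (2 ^ K)⁻¹ := by
    have h2 : (2 : ℝ) ^ (θ * N * s) = (2 ^ N) ^ (s * θ) := by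
      rw [← Real.rpow_natCast, ← Real.rpow_mul zero_le_two]
      congr 1
      ring
    rw [Real.rpow_sub (by positivity), Real.rpow_one, div_eq_mul_inv, h2,
      ← Real.mul_rpow (by positivity) (by positivity), ← pow_add]
    have h3 : ((n : ℝ) + 1) ≤ 2 ^ (c + 1 + N) := by
      rw [show c + 1 + N = K + 1 by omega]
      exact_mod_cast hnK.le
    have h4 : (2 : ℝ) ^ K ≤ n + 1 := by exact_mod_cast hKn
    gcongr
  have hE1 : E (n + 1) ^ s ≤ E (2 ^ K) ^ s := Real.rpow_le_rpow (hE0 _) (hE hKn) hs.le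
  have hEn := hE0 (n + 1)
  have hEK := hE0 (2 ^ K)
  rw [Real.norm_of_nonneg (by positivity)]
  calc _ ≤ (((c : ℝ) + 2) ^ (s * δ) * (N : ℝ) ^ (s * δ) * (N : ℝ)⁻¹) *
        (((2 : ℝ) ^ (c + 1)) ^ (s * θ) * 2 ^ (θ * N * s) * (2 ^ K)⁻¹) * E (2 ^ K) ^ s := by gcongr
    _ = _ := by
        have hNK : K - c = N := by omega
        simp only [hg, hNK]
        rw [Real.mul_rpow (by positivity) hEK, Real.mul_rpow (by positivity) (by positivity),
          ← Real.rpow_mul (Nat.cast_nonneg N), ← Real.rpow_mul zero_le_two, mul_comm δ s]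
        ring

/-- Lorentz summability passes to dyadic subsequences. -/
lemma summable_dyadic_of_summable_lorentz {r s : ℝ} (hs : 0 < s) {E : ℕ → ℝ}
    (hE0 : ∀ n, 0 ≤ E n) (hE : Antitone E)
    (h : Summable fun n : ℕ => ((n : ℝ) + 1) ^ (s / r - 1) * E (n + 1) ^ s) :
    Summable fun l : ℕ => ((2 : ℝ) ^ (1 / r * l) * E (2 ^ l)) ^ s := by
  set g : ℕ → ℝ := fun l => ((2 : ℝ) ^ (1 / r * l) * E (2 ^ (l + 1))) ^ s with hg
  have hg0 : ∀ l, 0 ≤ g l := fun l =>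
    Real.rpow_nonneg (mul_nonneg (by positivity) (hE0 _)) s
  have hgsum : Summable g := by
    refine (summable_comp_log_iff hg0).1 ?_
    refine Summable.of_nonneg_of_le (fun n => div_nonneg (hg0 _) (by positivity)) (fun n => ?_)
      (h.mul_left (2 * 2 ^ |s / r|))
    set K := Nat.log 2 (n + 1)
    have hKn : 2 ^ K ≤ n + 1 := Nat.pow_log_le_self 2 (by omega)
    have hnK : n + 1 < 2 ^ (K + 1) := Nat.lt_pow_succ_log_self one_lt_two _
    have hKn' : (2 : ℝ) ^ K ≤ n + 1 := by exact_mod_cast hKn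
    have hnK' : (n : ℝ) + 1 ≤ 2 * 2 ^ K := by
      have : (n : ℝ) + 1 ≤ 2 ^ (K + 1) := by exact_mod_cast hnK.le
      rwa [pow_succ, mul_comm] at this
    have hE1 : E (2 ^ (K + 1)) ^ s ≤ E (n + 1) ^ s :=
      Real.rpow_le_rpow (hE0 _) (hE hnK.le) hs.le
    have hpow : ((2 : ℝ) ^ K) ^ (s / r) ≤ 2 ^ |s / r| * ((n : ℝ) + 1) ^ (s / r) := by
      rcases le_total 0 (s / r) with hsr | hsr
      · calc ((2 : ℝ) ^ K) ^ (s / r) ≤ ((n : ℝ) + 1) ^ (s / r) := by gcongr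
          _ ≤ _ := le_mul_of_one_le_left (by positivity)
              (Real.one_le_rpow one_le_two (abs_nonneg _))
      · rw [abs_of_nonpos hsr, Real.rpow_neg zero_le_two, ← div_eq_inv_mul,
          le_div_iff₀ (by positivity), ← Real.mul_rpow (by positivity) zero_le_two, mul_comm]
        exact Real.rpow_le_rpow_of_nonpos (by positivity) hnK' hsr
    have hEn := hE0 (n + 1)
    have hEK := hE0 (2 ^ (K + 1))
    have hinv : ((2 : ℝ) ^ K)⁻¹ ≤ 2 * ((n : ℝ) + 1)⁻¹ := by
      rw [← div_eq_mul_inv, inv_le_comm₀ (by positivity) (by positivity), inv_div]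
      linarith
    calc g K / 2 ^ K = ((2 : ℝ) ^ K) ^ (s / r) * E (2 ^ (K + 1)) ^ s * (2 ^ K)⁻¹ := by
          rw [hg, div_eq_mul_inv]
          simp only
          rw [Real.mul_rpow (by positivity) (hE0 _), ← Real.rpow_natCast,
            ← Real.rpow_mul zero_le_two, ← Real.rpow_mul zero_le_two]
          congr 3
          ring
      _ ≤ 2 ^ |s / r| * ((n : ℝ) + 1) ^ (s / r) * E (n + 1) ^ s * (2 * ((n : ℝ) + 1)⁻¹) := by
          gcongr
      _ = _ := by
          rw [Real.rpow_sub (by positivity), Real.rpow_one]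
          ring
  rw [← summable_nat_add_iff 1]
  refine (hgsum.mul_left (((2 : ℝ) ^ (1 / r)) ^ s)).congr fun l => ?_
  rw [hg, ← Real.mul_rpow (by positivity) (mul_nonneg (by positivity) (hE0 _)), ← mul_assoc,
    ← Real.rpow_add two_pos]
  push_cast
  ring_nf

end Sequences

/-- Let `X` be a Banach space of type `p`, `1 < p ≤ 2`, let `0 < r < p'`
and `0 < s < ∞`. Then for every precompact `A ⊆ X`, if `(e_n(A)) ∈ l_{r,s}` then
`(e_n(aco A)) ∈ l_{p',s,α}` with `α = 1/s + 1/p' - 1/r`. -/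
theorem stmt0 {X : Type*} [NormedAddCommGroup X] [NormedSpace ℝ X] [CompleteSpace X]
    (p p' r s : ℝ) (hp1 : 1 < p) (hp2 : p ≤ 2) (hX : IsTypeP X p)
    (hp' : 1 / p + 1 / p' = 1) (hr0 : 0 < r) (hrp : r < p') (hs : 0 < s)
    (A : Set X) (hA : TotallyBounded A)
    (hmem : MemLorentz r s 0 fun n => dyadEntropyNum A n) :
    MemLorentz p' s (1 / s + 1 / p' - 1 / r)
      fun n => dyadEntropyNum (absConvHull A) n := by
  obtain ⟨ρ, hρ, hXρ⟩ := hX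
  have hp0 : 0 < p := by linarith
  have hθ : 1 - 1 / p = 1 / p' := by linarith
  have hp'0 : 0 < p' := hr0.trans hrp
  set δ := 1 / r - 1 / p' with hδdef
  have hδ : 0 < δ := sub_pos.2 (one_div_lt_one_div_of_lt hr0 hrp)
  have hθ0 : 0 < 1 / p' := by positivity
  have hθ1 : 1 / p' < 1 := by
    have : 0 < 1 / p := by positivity
    linarith
  have hη : δ / (2 * (1 / p')) * (1 / p') = δ / 2 := by field_simp
  obtain ⟨R, hR⟩ := hA.isBounded.exists_norm_le
  have hE0 : ∀ n, 0 ≤ dyadEntropyNum A n := dyadEntropyNum_nonneg A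
  have hE : Antitone (dyadEntropyNum A) := dyadEntropyNum_antitone hA.isBounded
  have hF : Antitone (dyadEntropyNum (absConvHull A)) :=
    dyadEntropyNum_antitone <| isBounded_iff_forall_norm_le.2 ⟨|R|,
      norm_le_of_mem_absConvHull (abs_nonneg R) fun a ha => (hR a ha).trans (le_abs_self R)⟩
  set β : ℕ → ℝ := fun l => dyadEntropyNum A (2 ^ l) + 2 ^ (-(2 / r * l)) with hβdef
  have hβ0 : ∀ l, 0 ≤ β l := fun l => add_nonneg (hE0 _) (by positivity)
  have hβanti : Antitone β := fun l m hlm => by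
    refine add_le_add (hE (Nat.pow_le_pow_right two_pos hlm))
      (Real.rpow_le_rpow_of_exponent_le one_le_two ?_)
    have : (l : ℝ) ≤ m := by exact_mod_cast hlm
    gcongr
  have hnet : ∀ l, HasNet A (2 ^ 2 ^ l) (β l) := fun l =>
    (HasNet.of_entropyNum_lt hA.isBounded Nat.one_le_two_pow
      (lt_add_of_pos_right (dyadEntropyNum A (2 ^ l)) (by positivity))).mono subset_rfl
      (Nat.pow_le_pow_right two_pos (Nat.sub_le _ _)) le_rfl
  have hβsum : Summable fun l : ℕ => ((2 : ℝ) ^ ((1 / p' + δ) * l) * β l) ^ s := by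
    have h1 : Summable fun l : ℕ => ((2 : ℝ) ^ (1 / r * l) * dyadEntropyNum A (2 ^ l)) ^ s :=
      summable_dyadic_of_summable_lorentz hs hE0 hE (by simpa [MemLorentz] using hmem)
    have h2 := summable_rpow_mul_two_rpow_neg 0 (by positivity : 0 < 1 / r * s)
    refine Summable.of_nonneg_of_le
      (fun l => Real.rpow_nonneg (mul_nonneg (by positivity) (hβ0 l)) s) (fun l => ?_)
      ((h1.add h2).mul_left (2 ^ s))
    have h3 : ((2 : ℝ) ^ (1 / r * l) * 2 ^ (-(2 / r * l))) ^ s =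
        (l : ℝ) ^ (0 : ℝ) * 2 ^ (-(1 / r * s * l)) := by
      rw [Real.rpow_zero, one_mul, ← Real.rpow_add two_pos, ← Real.rpow_mul zero_le_two]
      congr 1
      ring
    rw [← h3, hδdef, add_sub_cancel, hβdef, mul_add]
    exact add_rpow_le_two_rpow_mul (mul_nonneg (by positivity) (hE0 _)) (by positivity) hs
  obtain ⟨c, C, hC, hbound⟩ := hXρ.exists_dyadEntropyNum_absConvHull_le hp1 hρ.le hR hβ0 hβanti
    hnet (by positivity : 0 < δ / (2 * (1 / p')))
  rw [hθ] at hbound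
  have hfin := summable_lorentz_of_summable_dyadic hθ0 hδ hs (dyadEntropyNum_nonneg _) hF
    (summable_inv_mul_rpow_of_dyadic_bound hθ1 hδ hs hη hC (dyadEntropyNum_nonneg _) hβ0 hβsum
      hbound)
  have hexp : -((1 / s + 1 / p' - 1 / r) * s) = s * δ - 1 := by
    rw [hδdef]
    field_simp
    ring
  rw [MemLorentz, hexp]
  simpa only [mul_one_div] using hfin
end

section
/- Let 0 < t < r < ∞ and α ∈ ℝ. If σ_1 ≥ σ_2 ≥ … ≥ 0 is a non-increasing sequence of non-negative real numbers, then for all N ∈ ℕ: sup_{1 ≤ n ≤ N} (log(n+1))^α n^{1/r} ((1/n) Σ_{k=1}^n σ_k^t)^{1/t} ≤ c · sup_{1 ≤ k ≤ N} (log(k+1))^α k^{1/r} σ_k, where c = c(t,r,α) > 0 is a constant depending only on t, r and α. -/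
open MeasureTheory

open Finset in
theorem sum_Icc_rpow_neg_le {s : ℝ} (hs0 : 0 ≤ s) (hs1 : s < 1) (n : ℕ) :
    ∑ k ∈ Icc 1 n, (k : ℝ) ^ (-s) ≤ (n : ℝ) ^ (1 - s) / (1 - s) := by
  have hp : 0 < 1 - s := by linarith
  induction n with
  | zero => simp [Real.zero_rpow hp.ne']
  | succ n ih =>
    rw [Finset.sum_Icc_succ_top (by omega)]
    have hm : (0 : ℝ) < (n : ℝ) + 1 := by positivity
    have hinv : 1 / ((n : ℝ) + 1) ≤ 1 := by
      rw [div_le_one hm]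
      linarith [n.cast_nonneg (α := ℝ)]
    have bern := rpow_one_add_le_one_add_mul_self (s := -(1 / ((n : ℝ) + 1))) (p := 1 - s)
      (by linarith) hp.le (by linarith)
    have hn : (n : ℝ) ^ (1 - s) =
        (1 + -(1 / ((n : ℝ) + 1))) ^ (1 - s) * ((n : ℝ) + 1) ^ (1 - s) := by
      rw [← Real.mul_rpow (by linarith) hm.le]
      congr 1
      field_simp
      ring
    have hsplit : ((n : ℝ) + 1) ^ (1 - s) = ((n : ℝ) + 1) * ((n : ℝ) + 1) ^ (-s) := by
      rw [sub_eq_add_neg, Real.rpow_add hm, Real.rpow_one]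
    have step : (n : ℝ) ^ (1 - s) + (1 - s) * ((n : ℝ) + 1) ^ (-s) ≤ ((n : ℝ) + 1) ^ (1 - s) := by
      have h := mul_le_mul_of_nonneg_right bern (Real.rpow_nonneg hm.le (1 - s))
      rw [← hn] at h
      have e : (1 + (1 - s) * -(1 / ((n : ℝ) + 1))) * ((n : ℝ) + 1) ^ (1 - s)
          = ((n : ℝ) + 1) ^ (1 - s) - (1 - s) * ((n : ℝ) + 1) ^ (-s) := by
        rw [hsplit]
        field_simp
        ring
      linarith
    rw [le_div_iff₀ hp] at ih ⊢
    push_cast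
    linarith

theorem one_le_logb_two_add_one {k : ℕ} (hk : 1 ≤ k) : 1 ≤ Real.logb 2 ((k : ℝ) + 1) := by
  have hk' : (1 : ℝ) ≤ k := by exact_mod_cast hk
  rw [Real.le_logb_iff_rpow_le (by norm_num) (by positivity), Real.rpow_one]
  linarith

theorem logb_two_div_le {k n : ℕ} (hk : 1 ≤ k) (hkn : k ≤ n) :
    Real.logb 2 ((n : ℝ) + 1) / Real.logb 2 ((k : ℝ) + 1) ≤ 1 + Real.logb 2 ((n : ℝ) / k) := by
  have hk' : (1 : ℝ) ≤ k := by exact_mod_cast hk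
  have hkn' : (k : ℝ) ≤ n := by exact_mod_cast hkn
  have hk0 : (0 : ℝ) < k := by linarith
  have hn0 : (0 : ℝ) < n := by linarith
  have hL := one_le_logb_two_add_one hk
  have hlog0 : 0 ≤ Real.logb 2 ((n : ℝ) / k) :=
    Real.logb_nonneg (by norm_num) ((one_le_div hk0).2 hkn')
  have h1 : Real.logb 2 ((n : ℝ) + 1) ≤ Real.logb 2 ((k : ℝ) + 1) + Real.logb 2 ((n : ℝ) / k) := by
    rw [← Real.logb_mul (by positivity) (by positivity)]
    refine Real.logb_le_logb_of_le (by norm_num) (by positivity) ?_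
    have : ((k : ℝ) + 1) * (n / k) = n + n / k := by field_simp
    rw [this]
    linarith [(one_le_div hk0).2 hkn']
  rw [div_le_iff₀ (by linarith)]
  nlinarith

theorem exists_logb_two_div_rpow_le (α : ℝ) {δ : ℝ} (hδ : 0 < δ) :
    ∃ C > 0, ∀ k n : ℕ, 1 ≤ k → k ≤ n →
      (Real.logb 2 ((n : ℝ) + 1) / Real.logb 2 ((k : ℝ) + 1)) ^ α ≤ C * ((n : ℝ) / k) ^ δ := by
  have one_le_ratio {k n : ℕ} (hk : 1 ≤ k) (hkn : k ≤ n) :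
      1 ≤ Real.logb 2 ((n : ℝ) + 1) / Real.logb 2 ((k : ℝ) + 1) := by
    rw [one_le_div (by linarith [one_le_logb_two_add_one hk])]
    exact Real.logb_le_logb_of_le (by norm_num) (by positivity) (by gcongr)
  have one_le_quot {k n : ℕ} (hk : 1 ≤ k) (hkn : k ≤ n) : 1 ≤ (n : ℝ) / k := by
    rw [one_le_div (by exact_mod_cast hk)]
    exact_mod_cast hkn
  rcases le_or_gt α 0 with hα | hα
  · refine ⟨1, one_pos, fun k n hk hkn => ?_⟩
    rw [one_mul]
    exact (Real.rpow_le_one_of_one_le_of_nonpos (one_le_ratio hk hkn) hα).trans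
      (Real.one_le_rpow (one_le_quot hk hkn) hδ.le)
  · have he : 0 < δ / α := div_pos hδ hα
    have hlog2 : 0 < Real.log 2 := Real.log_pos (by norm_num)
    refine ⟨(1 + 1 / (δ / α * Real.log 2)) ^ α, by positivity, fun k n hk hkn => ?_⟩
    have hx := one_le_quot hk hkn
    have hx0 : (0 : ℝ) ≤ (n : ℝ) / k := by linarith
    have hbound : 1 + Real.logb 2 ((n : ℝ) / k)
        ≤ (1 + 1 / (δ / α * Real.log 2)) * ((n : ℝ) / k) ^ (δ / α) := by
      have h1 := Real.one_le_rpow hx he.le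
      have h2 : Real.logb 2 ((n : ℝ) / k) ≤ ((n : ℝ) / k) ^ (δ / α) / (δ / α) / Real.log 2 :=
        div_le_div_of_nonneg_right (Real.log_le_rpow_div hx0 he) hlog2.le
      rw [div_div] at h2
      calc _ ≤ ((n : ℝ) / k) ^ (δ / α) + ((n : ℝ) / k) ^ (δ / α) / (δ / α * Real.log 2) :=
            add_le_add h1 h2
        _ = _ := by ring
    calc _ ≤ ((1 + 1 / (δ / α * Real.log 2)) * ((n : ℝ) / k) ^ (δ / α)) ^ α :=
          Real.rpow_le_rpow (by linarith [one_le_ratio hk hkn])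
            ((logb_two_div_le hk hkn).trans hbound) hα.le
      _ = _ := by
          rw [Real.mul_rpow (by positivity) (by positivity), ← Real.rpow_mul hx0,
            div_mul_cancel₀ _ hα.ne']

/-- Hardy-type inequality: for `0 < t < r < ∞` and `α ∈ ℝ` there is
`c = c(t,r,α) > 0` such that for every non-increasing sequence `σ₁ ≥ σ₂ ≥ … ≥ 0` and all
`N ∈ ℕ`:
`sup_{1≤n≤N} (log(n+1))^α n^{1/r} ((1/n) ∑_{k=1}^n σ_k^t)^{1/t}
  ≤ c sup_{1≤k≤N} (log(k+1))^α k^{1/r} σ_k`. -/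
theorem stmt4 (t r α : ℝ) (ht : 0 < t) (htr : t < r) :
    ∃ c > 0, ∀ σ : ℕ → ℝ, (∀ n, 0 ≤ σ n) → Antitone σ →
      ∀ N n : ℕ, 1 ≤ n → n ≤ N →
        (Real.logb 2 ((n : ℝ) + 1)) ^ α * (n : ℝ) ^ (1 / r) *
            ((1 / (n : ℝ)) * ∑ k ∈ Finset.Icc 1 n, σ k ^ t) ^ (1 / t)
          ≤ c * sSup ((fun k : ℕ =>
              (Real.logb 2 ((k : ℝ) + 1)) ^ α * (k : ℝ) ^ (1 / r) * σ k) '' Set.Icc 1 N) := by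
  have hr : 0 < r := ht.trans htr
  have hrt : 1 / r < 1 / t := one_div_lt_one_div_of_lt ht htr
  obtain ⟨p, hrp, hpt⟩ := exists_between hrt
  have hp : 0 < p := (by positivity : 0 < 1 / r).trans hrp
  have hs : p * t < 1 := by rwa [lt_div_iff₀ ht] at hpt
  have hs' : 0 < 1 - p * t := by linarith
  obtain ⟨C, hC, hlog⟩ := exists_logb_two_div_rpow_le α (sub_pos.2 hrp)
  refine ⟨C * (1 / (1 - p * t)) ^ (1 / t), by positivity, fun σ hσ _ N n hn hnN => ?_⟩
  set w : ℕ → ℝ := fun k => (Real.logb 2 ((k : ℝ) + 1)) ^ α * (k : ℝ) ^ (1 / r)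
  have hLpos {k : ℕ} (hk : 1 ≤ k) : 0 < Real.logb 2 ((k : ℝ) + 1) := by
    linarith [one_le_logb_two_add_one hk]
  have hwpos {k : ℕ} (hk : 1 ≤ k) : 0 < w k := by
    have hk0 : (0 : ℝ) < k := by exact_mod_cast hk
    have := hLpos hk
    positivity
  change w n * _ ≤ _ * sSup ((fun k : ℕ => w k * σ k) '' Set.Icc 1 N)
  set M := sSup ((fun k : ℕ => w k * σ k) '' Set.Icc 1 N)
  have hM {k : ℕ} (hk : 1 ≤ k) (hkN : k ≤ N) : w k * σ k ≤ M :=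
    le_csSup ((Set.finite_Icc 1 N).image _).bddAbove ⟨k, ⟨hk, hkN⟩, rfl⟩
  have hM0 : 0 ≤ M := (mul_nonneg (hwpos hn).le (hσ n)).trans (hM hn hnN)
  have hn0 : (0 : ℝ) < n := by exact_mod_cast hn
  have hwn := hwpos hn
  have hterm {k : ℕ} (hk : 1 ≤ k) (hkn : k ≤ n) :
      σ k ^ t ≤ (C * M / w n) ^ t * (n : ℝ) ^ (p * t) * (k : ℝ) ^ (-(p * t)) := by
    have hk0 : (0 : ℝ) < k := by exact_mod_cast hk
    have hwk := hwpos hk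
    have hratio : w n / w k ≤ C * ((n : ℝ) / k) ^ p := by
      calc w n / w k = (Real.logb 2 ((n : ℝ) + 1) / Real.logb 2 ((k : ℝ) + 1)) ^ α
              * ((n : ℝ) / k) ^ (1 / r) := by
            rw [Real.div_rpow (hLpos hn).le (hLpos hk).le, Real.div_rpow hn0.le hk0.le,
              div_mul_div_comm]
        _ ≤ C * ((n : ℝ) / k) ^ (p - 1 / r) * ((n : ℝ) / k) ^ (1 / r) := by
            gcongr
            exact hlog k n hk hkn
        _ = _ := by
            rw [mul_assoc, ← Real.rpow_add (by positivity), sub_add_cancel]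
    have hσk : σ k ≤ C * M / w n * ((n : ℝ) / k) ^ p := by
      calc σ k = (w n / w k) * (w k * σ k) / w n := by field_simp
        _ ≤ (C * ((n : ℝ) / k) ^ p) * M / w n := by
            gcongr
            · exact mul_nonneg hwk.le (hσ k)
            · exact hM hk (hkn.trans hnN)
        _ = _ := by ring
    calc σ k ^ t ≤ (C * M / w n * ((n : ℝ) / k) ^ p) ^ t :=
          Real.rpow_le_rpow (hσ k) hσk ht.le
      _ = _ := by
          rw [Real.mul_rpow (by positivity) (by positivity), ← Real.rpow_mul (by positivity),
            Real.div_rpow hn0.le hk0.le, Real.rpow_neg hk0.le]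
          ring
  have hsum : (1 / (n : ℝ)) * ∑ k ∈ Finset.Icc 1 n, σ k ^ t
      ≤ (C * M / w n) ^ t * (1 / (1 - p * t)) := by
    calc (1 / (n : ℝ)) * ∑ k ∈ Finset.Icc 1 n, σ k ^ t
        ≤ (1 / (n : ℝ)) * ∑ k ∈ Finset.Icc 1 n,
            (C * M / w n) ^ t * (n : ℝ) ^ (p * t) * (k : ℝ) ^ (-(p * t)) := by
          gcongr with k hk
          rw [Finset.mem_Icc] at hk
          exact hterm hk.1 hk.2
      _ ≤ (1 / (n : ℝ)) * ((C * M / w n) ^ t * (n : ℝ) ^ (p * t) *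
            ((n : ℝ) ^ (1 - p * t) / (1 - p * t))) := by
          rw [← Finset.mul_sum]
          gcongr
          exact sum_Icc_rpow_neg_le (by positivity) hs n
      _ = (C * M / w n) ^ t * (1 / (1 - p * t)) := by
          rw [Real.rpow_sub hn0, Real.rpow_one]
          field_simp
  calc w n * ((1 / (n : ℝ)) * ∑ k ∈ Finset.Icc 1 n, σ k ^ t) ^ (1 / t)
      ≤ w n * ((C * M / w n) ^ t * (1 / (1 - p * t))) ^ (1 / t) := by
        gcongr
        exact mul_nonneg (by positivity)
          (Finset.sum_nonneg fun k _ => Real.rpow_nonneg (hσ k) t)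
    _ = w n * (C * M / w n * (1 / (1 - p * t)) ^ (1 / t)) := by
        rw [Real.mul_rpow (by positivity) (by positivity), ← Real.rpow_mul (by positivity),
          mul_one_div_cancel ht.ne', Real.rpow_one]
    _ = _ := by field_simp
end

section
/- Let σ_1 ≥ σ_2 ≥ … ≥ 0 be a non-increasing sequence of non-negative real numbers, let 1 < p ≤ 2, and let A = {σ_n u_n : n ∈ ℕ} ⊂ l_p, where (u_n) is the canonical unit vector basis of l_p. Then for all n ∈ ℕ: ε_n(A) ≤ σ_n and e_n(aco(A)) ≥ c · max{ n^{−1/p'} (log(n+1))^{1/p'} σ_{n²}, σ_{2^n} }, where c = c(p) > 0 is a constant depending only on p. -/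
open MeasureTheory

/-- If every point of a finite family in `A` is `d`-separated from all but at most `M` members of
the family, and the family has more than `K * M` members, then `A` cannot be covered by `K` balls
of radius less than `d / 2`. -/
theorem half_le_entropyNum_of_card_lt {X ι : Type*} [PseudoMetricSpace X] [Fintype ι] {A : Set X}
    {a : X} {r d : ℝ} {K M : ℕ} (hK : 1 ≤ K) (hr : 0 ≤ r) (hA : A ⊆ Metric.closedBall a r)
    (x : ι → X) (hx : ∀ f, x f ∈ A)
    (hM : ∀ f, ∀ F : Finset ι, M < F.card → ∃ g ∈ F, d ≤ dist (x f) (x g))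
    (hcard : K * M < Fintype.card ι) : d / 2 ≤ entropyNum A K := by
  classical
  refine le_csInf ⟨r, hr, {a}, by simpa using hK, by simpa using hA⟩ ?_
  rintro ε ⟨-, T, hT, hcov⟩
  have hball : ∀ f, ∃ t ∈ T, dist (x f) t ≤ ε := fun f ↦ by
    simpa using hcov (hx f)
  choose t htT ht using hball
  obtain ⟨y, -, hy⟩ := Finset.exists_lt_card_fiber_of_mul_lt_card_of_maps_to
    (s := Finset.univ) (t := T) (f := t) (n := M) (fun f _ ↦ htT f)
    (lt_of_le_of_lt (Nat.mul_le_mul_right M hT) (by simpa using hcard))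
  obtain ⟨f, hf⟩ := Finset.card_pos.mp (Nat.zero_lt_of_lt hy)
  obtain ⟨g, hg, hd⟩ := hM f _ hy
  have hf' : t f = y := by simpa using hf
  have hg' : t g = y := by simpa using hg
  have h1 := ht f
  have h2 := ht g
  rw [hf'] at h1
  rw [hg'] at h2
  have := dist_triangle_right (x f) (x g) y
  linarith

/-- A version of `half_le_entropyNum_of_card_lt` for a family of pairwise `d`-separated points. -/
theorem half_le_entropyNum_of_pairwise {X ι : Type*} [PseudoMetricSpace X] [Fintype ι] {A : Set X}
    {a : X} {r d : ℝ} {K : ℕ} (hK : 1 ≤ K) (hr : 0 ≤ r) (hA : A ⊆ Metric.closedBall a r)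
    (x : ι → X) (hx : ∀ f, x f ∈ A) (hd : Pairwise fun f g ↦ d ≤ dist (x f) (x g))
    (hcard : K < Fintype.card ι) : d / 2 ≤ entropyNum A K := by
  refine half_le_entropyNum_of_card_lt (M := 1) hK hr hA x hx (fun f F hF ↦ ?_) (by simpa)
  obtain ⟨g, hg, hne⟩ := Finset.exists_mem_ne hF f
  exact ⟨g, hg, hd hne.symm⟩

/-- A Hamming ball of radius `m` in `q ^ k` has at most `2 ^ k * q ^ m` elements. -/
theorem exists_lt_hammingDist_of_card_lt {k q m : ℕ} (hq : 1 ≤ q) (f : Fin k → Fin q)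
    (F : Finset (Fin k → Fin q)) (hF : 2 ^ k * q ^ m < F.card) :
    ∃ g ∈ F, m < hammingDist f g := by
  classical
  by_contra! h
  refine hF.not_ge ?_
  have hsub : F ⊆ (Finset.univ.filter fun D : Finset (Fin k) ↦ D.card ≤ m).biUnion fun D ↦
      Fintype.piFinset fun i ↦ if i ∈ D then Finset.univ else {f i} := by
    intro g hg
    simp only [Finset.mem_biUnion, Finset.mem_filter, Finset.mem_univ, true_and]
    refine ⟨Finset.univ.filter fun i ↦ f i ≠ g i, h g hg, ?_⟩
    rw [Fintype.mem_piFinset]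
    intro i
    by_cases hi : f i = g i <;> simp [hi]
  refine (Finset.card_le_card hsub).trans
    ((Finset.card_biUnion_le_card_mul _ _ (q ^ m) ?_).trans ?_)
  · intro D hD
    rw [Fintype.card_piFinset]
    have : ∀ i, (if i ∈ D then (Finset.univ : Finset (Fin q)) else {f i}).card =
        if i ∈ D then q else 1 := by
      intro i
      split_ifs <;> simp
    simp only [this, Finset.prod_ite_mem, Finset.univ_inter, Finset.prod_const]
    exact Nat.pow_le_pow_right hq (by simpa using hD)
  · refine Nat.mul_le_mul_right _ ((Finset.card_filter_le _ _).trans ?_)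
    simp

section ScaledBasis

variable {P : ENNReal}

/-- The set `{σ_m u_m : m ≥ 1}` of scaled unit vectors in `l_P`. -/
def scaledBasis (P : ENNReal) (σ : ℕ → ℝ) : Set (lp (fun _ : ℕ => ℝ) P) :=
  {x | ∃ m : ℕ, 1 ≤ m ∧ x = σ m • lp.single P m (1 : ℝ)}

theorem subset_absConvHull {X : Type*} [AddCommGroup X] [Module ℝ X] (A : Set X) :
    A ⊆ absConvHull A :=
  fun x hx ↦ ⟨1, fun _ ↦ x, fun _ ↦ 1, fun _ ↦ hx, by simp, by simp⟩

theorem average_mem_absConvHull {X : Type*} [AddCommGroup X] [Module ℝ X] {A : Set X} {k : ℕ}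
    {a : Fin k → X} (ha : ∀ i, a i ∈ A) : ∑ i, (1 / (k : ℝ)) • a i ∈ absConvHull A := by
  refine ⟨k, a, fun _ ↦ 1 / (k : ℝ), ha, ?_, rfl⟩
  rcases Nat.eq_zero_or_pos k with rfl | hk
  · simp
  · have : (k : ℝ) ≠ 0 := by positivity
    simp [this]

theorem absConvHull_subset_closedBall {X : Type*} [SeminormedAddCommGroup X] [NormedSpace ℝ X]
    {A : Set X} {r : ℝ} (hr : 0 ≤ r) (hA : A ⊆ Metric.closedBall 0 r) :
    absConvHull A ⊆ Metric.closedBall 0 r := by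
  rintro x ⟨n, a, lam, ha, hlam, rfl⟩
  rw [mem_closedBall_zero_iff]
  calc ‖∑ i, lam i • a i‖ ≤ ∑ i, |lam i| * r := by
        refine norm_sum_le_of_le _ fun i _ ↦ ?_
        rw [norm_smul, Real.norm_eq_abs]
        exact mul_le_mul_of_nonneg_left (mem_closedBall_zero_iff.mp (hA (ha i))) (abs_nonneg _)
    _ = (∑ i, |lam i|) * r := (Finset.sum_mul ..).symm
    _ ≤ r := mul_le_of_le_one_left hr hlam

variable {σ : ℕ → ℝ}

theorem smul_single_apply (m j : ℕ) :
    (σ m • (lp.single P m (1 : ℝ) : lp (fun _ : ℕ => ℝ) P)) j = if j = m then σ m else 0 := by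
  rw [lp.coeFn_smul, Pi.smul_apply, lp.single_apply, Pi.single_apply, smul_eq_mul, mul_ite,
    mul_one, mul_zero]

/-- The vector with coordinates `σ / k` at the positions `e (i, f i)` and `0` elsewhere. -/
noncomputable def blockVec (P : ENNReal) (σ : ℕ → ℝ) {k q : ℕ}
    (e : Fin k × Fin q → ℕ) (f : Fin k → Fin q) : lp (fun _ : ℕ => ℝ) P :=
  ∑ i, (1 / (k : ℝ)) • (σ (e (i, f i)) • lp.single P (e (i, f i)) (1 : ℝ))

theorem blockVec_mem {k q : ℕ} {e : Fin k × Fin q → ℕ} (he : ∀ a, 1 ≤ e a) (f : Fin k → Fin q) :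
    blockVec P σ e f ∈ absConvHull (scaledBasis P σ) :=
  average_mem_absConvHull fun i ↦ ⟨_, he (i, f i), rfl⟩

theorem blockVec_apply {k q : ℕ} {e : Fin k × Fin q → ℕ} (he : e.Injective) (f : Fin k → Fin q)
    (i : Fin k) (j : Fin q) :
    blockVec P σ e f (e (i, j)) = if f i = j then σ (e (i, j)) / k else 0 := by
  have hterm : ∀ b, ((1 / (k : ℝ)) • (σ (e (b, f b)) •
      (lp.single P (e (b, f b)) (1 : ℝ) : lp (fun _ : ℕ => ℝ) P)) : lp (fun _ : ℕ => ℝ) P)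
        (e (i, j)) = if b = i then (if f i = j then σ (e (i, j)) / k else 0) else 0 := by
    intro b
    rw [lp.coeFn_smul, Pi.smul_apply, smul_single_apply]
    by_cases hb : b = i
    · subst hb
      by_cases h : f b = j
      · simp [h, div_eq_inv_mul]
      · simp [he.eq_iff, h, Ne.symm h]
    · simp [he.eq_iff, hb, Ne.symm hb]
  rw [blockVec, lp.coeFn_sum, Finset.sum_apply, Finset.sum_congr rfl fun b _ ↦ hterm b,
    Finset.sum_ite_eq' Finset.univ i, if_pos (Finset.mem_univ i)]

variable [Fact (1 ≤ P)]

theorem norm_smul_single (hσ : ∀ n, 0 ≤ σ n) (m : ℕ) :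
    ‖σ m • (lp.single P m (1 : ℝ) : lp (fun _ : ℕ => ℝ) P)‖ = σ m := by
  have hP : 0 < P := lt_of_lt_of_le one_pos (Fact.out : 1 ≤ P)
  rw [norm_smul, lp.norm_single hP, norm_one, mul_one, Real.norm_of_nonneg (hσ m)]

theorem scaledBasis_subset_closedBall (hσ : ∀ n, 0 ≤ σ n) (hanti : Antitone σ) :
    scaledBasis P σ ⊆ Metric.closedBall 0 (σ 1) := by
  rintro _ ⟨m, hm, rfl⟩
  rw [mem_closedBall_zero_iff, norm_smul_single hσ]
  exact hanti hm

theorem entropyNum_scaledBasis_le (hσ : ∀ n, 0 ≤ σ n) (hanti : Antitone σ) {n : ℕ} (hn : 1 ≤ n) :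
    entropyNum (scaledBasis P σ) n ≤ σ n := by
  classical
  refine csInf_le ⟨0, fun _ h ↦ h.1⟩ ⟨hσ n, insert 0 ((Finset.Ico 1 n).image fun m ↦
    σ m • (lp.single P m (1 : ℝ) : lp (fun _ : ℕ => ℝ) P)), ?_, ?_⟩
  · refine (Finset.card_insert_le _ _).trans ?_
    have := Finset.card_image_le (s := Finset.Ico 1 n) (f := fun m ↦
      σ m • (lp.single P m (1 : ℝ) : lp (fun _ : ℕ => ℝ) P))
    rw [Nat.card_Ico] at this
    omega
  · rintro _ ⟨m, hm, rfl⟩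
    simp only [Set.mem_iUnion]
    rcases lt_or_ge m n with h | h
    · exact ⟨_, Finset.mem_insert_of_mem (Finset.mem_image_of_mem _ (Finset.mem_Ico.mpr ⟨hm, h⟩)),
        Metric.mem_closedBall_self (hσ n)⟩
    · refine ⟨0, Finset.mem_insert_self _ _, ?_⟩
      rw [mem_closedBall_zero_iff, norm_smul_single hσ]
      exact hanti h

theorem half_le_entropyNum_absConvHull_of_lt (hσ : ∀ n, 0 ≤ σ n) (hanti : Antitone σ) {K N : ℕ}
    (hK : 1 ≤ K) (hKN : K < N) : σ N / 2 ≤ entropyNum (absConvHull (scaledBasis P σ)) K := by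
  refine half_le_entropyNum_of_pairwise hK (hσ 1)
    (absConvHull_subset_closedBall (hσ 1) (scaledBasis_subset_closedBall hσ hanti))
    (fun i : Fin N ↦ σ (i + 1) • (lp.single P ((i : ℕ) + 1) (1 : ℝ) : lp (fun _ : ℕ => ℝ) P))
    (fun i ↦ subset_absConvHull _ ⟨i + 1, by omega, rfl⟩) ?_ (by simpa using hKN)
  intro i j hij
  have hP : P ≠ 0 := (lt_of_lt_of_le one_pos (Fact.out : 1 ≤ P)).ne'
  have hij' : (i : ℕ) ≠ j := fun h ↦ hij (Fin.ext h)
  have := lp.norm_apply_le_norm hP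
    (σ (i + 1) • (lp.single P ((i : ℕ) + 1) (1 : ℝ) : lp (fun _ : ℕ => ℝ) P) -
      σ (j + 1) • (lp.single P ((j : ℕ) + 1) (1 : ℝ) : lp (fun _ : ℕ => ℝ) P)) (i + 1)
  rw [dist_eq_norm]
  refine le_trans ?_ this
  rw [lp.coeFn_sub, Pi.sub_apply, smul_single_apply, smul_single_apply, if_pos rfl,
    if_neg (by omega), sub_zero, Real.norm_of_nonneg (hσ _)]
  exact hanti (by omega)

theorem div_le_entropyNum_absConvHull (hσ : ∀ n, 0 ≤ σ n) (hanti : Antitone σ) {K : ℕ}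
    (hK : 1 ≤ K) : σ 1 / K / 2 ≤ entropyNum (absConvHull (scaledBasis P σ)) K := by
  have hK' : (0 : ℝ) < K := by exact_mod_cast hK
  refine half_le_entropyNum_of_pairwise hK (hσ 1)
    (absConvHull_subset_closedBall (hσ 1) (scaledBasis_subset_closedBall hσ hanti))
    (fun i : Fin (K + 1) ↦ ((i : ℝ) / K) •
      (σ 1 • (lp.single P 1 (1 : ℝ) : lp (fun _ : ℕ => ℝ) P))) (fun i ↦ ?_) ?_ (by simp)
  · refine ⟨1, fun _ ↦ σ 1 • lp.single P 1 (1 : ℝ), fun _ ↦ (i : ℝ) / K,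
      fun _ ↦ ⟨1, le_rfl, rfl⟩, ?_, by simp⟩
    have hi : ((i : ℕ) : ℝ) ≤ K := by exact_mod_cast Nat.lt_succ_iff.mp i.2
    rw [Fin.sum_univ_one, abs_of_nonneg (by positivity)]
    exact (div_le_one hK').mpr hi
  · intro i j hij
    have h1 : (1 : ℝ) ≤ |((i : ℕ) : ℝ) - ((j : ℕ) : ℝ)| := by
      have : (1 : ℤ) ≤ |((i : ℕ) : ℤ) - ((j : ℕ) : ℤ)| :=
        Int.one_le_abs (sub_ne_zero.mpr fun h ↦ hij (Fin.ext (by exact_mod_cast h)))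
      exact_mod_cast this
    rw [dist_eq_norm, ← sub_smul, norm_smul, norm_smul_single hσ, ← sub_div, Real.norm_eq_abs,
      abs_div, abs_of_pos hK', div_mul_eq_mul_div]
    have := le_mul_of_one_le_left (hσ 1) h1
    gcongr

theorem le_dist_blockVec (hP : P ≠ ⊤) (hσ : ∀ n, 0 ≤ σ n) {k q : ℕ} (hk : 1 ≤ k)
    {e : Fin k × Fin q → ℕ} (he : e.Injective) {s : ℝ} (hs0 : 0 ≤ s) (hs : ∀ a, s ≤ σ (e a))
    (f g : Fin k → Fin q) (hfg : (k : ℝ) / 2 ≤ hammingDist f g) :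
    s / 2 * (k : ℝ) ^ (1 / P.toReal - 1) ≤ dist (blockVec P σ e f) (blockVec P σ e g) := by
  classical
  set r := P.toReal with hr
  have hr1 : 1 ≤ r := by
    simpa using ENNReal.toReal_mono hP (Fact.out : 1 ≤ P)
  have hk' : (0 : ℝ) < k := by exact_mod_cast hk
  rw [dist_eq_norm]
  have hsum := lp.sum_rpow_le_norm_rpow (p := P) (by linarith)
    (blockVec P σ e f - blockVec P σ e g)
    ((Finset.univ.filter fun i ↦ f i ≠ g i).image fun i ↦ e (i, f i))
  rw [Finset.sum_image (fun i _ j _ h ↦ congrArg Prod.fst (he h))] at hsum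
  have hterm : ∀ i ∈ Finset.univ.filter fun i ↦ f i ≠ g i, (s / k) ^ r ≤
      ‖(blockVec P σ e f - blockVec P σ e g : lp (fun _ : ℕ => ℝ) P) (e (i, f i))‖ ^ r := by
    intro i hi
    have hi' : g i ≠ f i := fun h ↦ (Finset.mem_filter.mp hi).2 h.symm
    rw [lp.coeFn_sub, Pi.sub_apply, blockVec_apply he, blockVec_apply he, if_pos rfl, if_neg hi',
      sub_zero, Real.norm_of_nonneg (div_nonneg (hσ _) hk'.le)]
    have := hs (i, f i)
    gcongr
  have h2 := (Finset.card_nsmul_le_sum _ _ _ hterm).trans hsum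
  rw [nsmul_eq_mul] at h2
  have h3 : (k : ℝ) / 2 * (s / k) ^ r ≤ ‖blockVec P σ e f - blockVec P σ e g‖ ^ r :=
    (mul_le_mul_of_nonneg_right hfg (by positivity)).trans h2
  refine (Real.rpow_le_rpow_iff (z := r) (by positivity) (norm_nonneg _) (by linarith)).mp
    (le_trans ?_ h3)
  have hkr : ((k : ℝ) ^ (1 / r - 1)) ^ r = k / (k : ℝ) ^ r := by
    rw [← Real.rpow_mul hk'.le, sub_mul, one_div_mul_cancel (by linarith), one_mul,
      Real.rpow_sub hk', Real.rpow_one]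
  rw [Real.mul_rpow (by positivity) (by positivity), hkr, Real.div_rpow hs0 two_pos.le,
    Real.div_rpow hs0 hk'.le]
  have h4 : (2 : ℝ) ≤ 2 ^ r := by
    simpa using Real.rpow_le_rpow_of_exponent_le one_le_two hr1
  calc s ^ r / 2 ^ r * (k / (k : ℝ) ^ r) ≤ s ^ r / 2 * (k / (k : ℝ) ^ r) := by gcongr
    _ = k / 2 * (s ^ r / (k : ℝ) ^ r) := by ring

theorem le_entropyNum_absConvHull (hP : P ≠ ⊤) (hσ : ∀ n, 0 ≤ σ n) (hanti : Antitone σ)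
    {n m K : ℕ} (hm : 1 ≤ m) (hmn : 2 * m ≤ n) (hK : 1 ≤ K)
    (hcard : K * (2 ^ (2 * m) * n ^ m) < n ^ (2 * m)) :
    σ (n ^ 2) / 4 * ((2 * m : ℕ) : ℝ) ^ (1 / P.toReal - 1) ≤
      entropyNum (absConvHull (scaledBasis P σ)) K := by
  set e : Fin (2 * m) × Fin n → ℕ := fun a ↦ (finProdFinEquiv a : ℕ) + 1 with he_def
  have he : e.Injective := fun a b h ↦ finProdFinEquiv.injective (Fin.ext (by simpa [e] using h))
  have hle : ∀ a, σ (n ^ 2) ≤ σ (e a) := fun a ↦ hanti <| by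
    have h1 := (finProdFinEquiv a).2
    have h2 : 2 * m * n ≤ n ^ 2 := by nlinarith
    change (finProdFinEquiv a : ℕ) + 1 ≤ n ^ 2
    omega
  have := half_le_entropyNum_of_card_lt (M := 2 ^ (2 * m) * n ^ m)
    (d := σ (n ^ 2) / 2 * ((2 * m : ℕ) : ℝ) ^ (1 / P.toReal - 1)) hK (hσ 1)
    (absConvHull_subset_closedBall (hσ 1) (scaledBasis_subset_closedBall hσ hanti))
    (blockVec P σ e) (blockVec_mem fun a ↦ by simp [e]) (fun f F hF ↦ ?_) (by simpa using hcard)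
  · linarith
  · obtain ⟨g, hg, hd⟩ := exists_lt_hammingDist_of_card_lt (by omega) f F hF
    refine ⟨g, hg, le_dist_blockVec hP hσ (by omega) he (hσ _) hle f g ?_⟩
    have : (m : ℝ) ≤ hammingDist f g := by exact_mod_cast hd.le
    push_cast
    linarith

end ScaledBasis

/-- A choice of the number `2 * m ~ n / log n` of blocks. -/
theorem exists_block_count {n : ℕ} (hn : 32 ≤ n) : ∃ m : ℕ, 1 ≤ m ∧ 2 * m ≤ n ∧
    2 ^ (n - 1) * (2 ^ (2 * m) * n ^ m) < n ^ (2 * m) ∧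
    ((2 * m : ℕ) : ℝ) * Real.logb 2 ((n : ℝ) + 1) ≤ 8 * n := by
  set L := Nat.log 2 n with hL
  have hL5 : 5 ≤ L := Nat.le_log_of_pow_le (by norm_num) (by simpa using hn)
  have hLn : 2 ^ L ≤ n := Nat.pow_log_le_self 2 (by omega)
  have hnL : n < 2 ^ (L + 1) := Nat.lt_pow_succ_log_self (by norm_num) n
  have hLn' : L < n := Nat.lt_two_pow_self.trans_le hLn
  have hlow : 2 * n < L * (2 * n / L + 1) := Nat.lt_mul_div_succ _ (by omega)
  have hup : L * (2 * n / L) ≤ 2 * n := Nat.mul_div_le _ _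
  set d := 2 * n / L
  have hd : 5 * d ≤ 2 * n := (Nat.mul_le_mul_right d hL5).trans hup
  refine ⟨d + 1, by omega, by omega, ?_, ?_⟩
  · have h1 : n - 1 + 2 * (d + 1) < L * (d + 1) := by
      have : 5 * (d + 1) ≤ L * (d + 1) := Nat.mul_le_mul_right _ hL5
      omega
    have h2 : 2 ^ (n - 1) * 2 ^ (2 * (d + 1)) < n ^ (d + 1) := by
      rw [← pow_add]
      refine lt_of_lt_of_le (Nat.pow_lt_pow_right (by norm_num) h1) ?_
      rw [pow_mul]
      exact Nat.pow_le_pow_left hLn _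
    rw [← mul_assoc, two_mul (d + 1), pow_add n (d + 1), ← two_mul]
    exact Nat.mul_lt_mul_of_pos_right h2 (by positivity)
  · have h1 : Real.logb 2 ((n : ℝ) + 1) ≤ L + 1 := by
      rw [Real.logb_le_iff_le_rpow one_lt_two (by positivity)]
      exact_mod_cast hnL
    have h2 : (2 * (d + 1)) * (L + 1) ≤ 8 * n := by nlinarith
    calc ((2 * (d + 1) : ℕ) : ℝ) * Real.logb 2 ((n : ℝ) + 1)
        ≤ ((2 * (d + 1) : ℕ) : ℝ) * (L + 1) := by gcongr
      _ ≤ 8 * n := by exact_mod_cast h2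

theorem logb_two_add_one_le (n : ℕ) : Real.logb 2 ((n : ℝ) + 1) ≤ n := by
  rw [Real.logb_le_iff_le_rpow one_lt_two (by positivity), Real.rpow_natCast]
  exact_mod_cast Nat.lt_two_pow_self (n := n)

/-- For a non-increasing sequence `σ₁ ≥ σ₂ ≥ … ≥ 0`, `1 < p ≤ 2` and
`A = {σ_n u_n : n ∈ ℕ} ⊆ l_p`: `ε_n(A) ≤ σ_n` and
`e_n(aco A) ≥ c max{n^{-1/p'} (log(n+1))^{1/p'} σ_{n²}, σ_{2^n}}` with `c = c(p) > 0`. -/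
theorem stmt5 (p p' : ℝ) (hp1 : 1 < p) (hp2 : p ≤ 2) (hp' : 1 / p + 1 / p' = 1) :
    letI : Fact (1 ≤ ENNReal.ofReal p) := ⟨ENNReal.one_le_ofReal.mpr hp1.le⟩
    ∃ c > 0, ∀ σ : ℕ → ℝ, (∀ n, 0 ≤ σ n) → Antitone σ →
      ∀ n : ℕ, 1 ≤ n →
        entropyNum
            {x : lp (fun _ : ℕ => ℝ) (ENNReal.ofReal p) |
              ∃ m : ℕ, 1 ≤ m ∧ x = σ m • lp.single (ENNReal.ofReal p) m (1 : ℝ)} n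
          ≤ σ n ∧
        c * max ((n : ℝ) ^ (-(1 / p')) * (Real.logb 2 ((n : ℝ) + 1)) ^ (1 / p') * σ (n ^ 2))
              (σ (2 ^ n))
          ≤ dyadEntropyNum
              (absConvHull {x : lp (fun _ : ℕ => ℝ) (ENNReal.ofReal p) |
                ∃ m : ℕ, 1 ≤ m ∧ x = σ m • lp.single (ENNReal.ofReal p) m (1 : ℝ)}) n := by
  have : Fact (1 ≤ ENNReal.ofReal p) := ⟨ENNReal.one_le_ofReal.mpr hp1.le⟩
  have htr : (ENNReal.ofReal p).toReal = p := ENNReal.toReal_ofReal (by linarith)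
  have hθ : 1 / p - 1 = -(1 / p') := by linarith
  have hθ0 : 0 ≤ 1 / p' := by
    have : 1 / p ≤ 1 := by rw [div_le_one (by linarith)]; exact hp1.le
    linarith
  have hθ1 : 1 / p' ≤ 1 := by
    have : 0 ≤ 1 / p := by positivity
    linarith
  refine ⟨1 / 2 ^ 32, by positivity, fun σ hσ hanti n hn ↦
    ⟨entropyNum_scaledBasis_le hσ hanti hn, ?_⟩⟩
  change _ ≤ entropyNum (absConvHull (scaledBasis (ENNReal.ofReal p) σ)) (2 ^ (n - 1))
  have hn0 : (0 : ℝ) < n := by exact_mod_cast hn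
  have hlog0 : 0 ≤ Real.logb 2 ((n : ℝ) + 1) := Real.logb_nonneg one_lt_two (by linarith)
  rw [mul_max_of_nonneg _ _ (by positivity), Real.rpow_neg hn0.le, ← div_eq_inv_mul,
    ← Real.div_rpow hlog0 hn0.le]
  refine max_le ?_ ?_
  · rcases lt_or_ge n 32 with h32 | h32
    · have h1 := div_le_entropyNum_absConvHull (P := ENNReal.ofReal p) hσ hanti
        (K := 2 ^ (n - 1)) Nat.one_le_two_pow
      have h2 : (Real.logb 2 ((n : ℝ) + 1) / n) ^ (1 / p') ≤ 1 :=
        Real.rpow_le_one (by positivity) ((div_le_one hn0).mpr (logb_two_add_one_le n)) hθ0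
      have h3 : (Real.logb 2 ((n : ℝ) + 1) / n) ^ (1 / p') * σ (n ^ 2) ≤ σ 1 :=
        (mul_le_of_le_one_left (hσ _) h2).trans (hanti (Nat.one_le_pow _ _ hn))
      refine le_trans ?_ h1
      have h4 : (2 : ℝ) ^ (n - 1) * 2 ≤ 2 ^ 32 := by
        rw [← pow_succ]
        exact pow_le_pow_right₀ one_le_two (by omega)
      push_cast
      rw [div_div, ← one_div_mul_eq_div (_ * _) (σ 1)]
      exact mul_le_mul (one_div_le_one_div_of_le (by positivity) h4) h3
        (mul_nonneg (by positivity) (hσ _)) (by positivity)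
    · obtain ⟨m, hm, hmn, hcard, hlog⟩ := exists_block_count h32
      refine le_trans ?_ (le_entropyNum_absConvHull ENNReal.ofReal_ne_top hσ hanti hm hmn
        Nat.one_le_two_pow hcard)
      rw [htr, hθ]
      have hk : (0 : ℝ) < ((2 * m : ℕ) : ℝ) := by exact_mod_cast (by omega : 0 < 2 * m)
      set k : ℝ := ((2 * m : ℕ) : ℝ)
      have h1 : Real.logb 2 ((n : ℝ) + 1) / n ≤ 8 * k⁻¹ := by
        rw [div_le_iff₀ hn0, mul_right_comm, ← div_eq_mul_inv, le_div_iff₀ hk]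
        linarith
      have h2 : (Real.logb 2 ((n : ℝ) + 1) / n) ^ (1 / p') ≤ 8 * k ^ (-(1 / p')) :=
        calc _ ≤ (8 * k⁻¹) ^ (1 / p') := Real.rpow_le_rpow (by positivity) h1 hθ0
          _ = 8 ^ (1 / p') * k ^ (-(1 / p')) := by
            rw [Real.mul_rpow (by norm_num) (by positivity), Real.inv_rpow hk.le,
              Real.rpow_neg hk.le]
          _ ≤ 8 * k ^ (-(1 / p')) := by
            gcongr
            simpa using Real.rpow_le_rpow_of_exponent_le (by norm_num : (1 : ℝ) ≤ 8) hθ1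
      have h3 := mul_le_mul_of_nonneg_right h2 (hσ (n ^ 2))
      have h4 : 0 ≤ k ^ (-(1 / p')) * σ (n ^ 2) := mul_nonneg (by positivity) (hσ _)
      linarith
  · have h1 := half_le_entropyNum_absConvHull_of_lt (P := ENNReal.ofReal p) hσ hanti
      (K := 2 ^ (n - 1)) (N := 2 ^ n) Nat.one_le_two_pow
      (Nat.pow_lt_pow_right one_lt_two (by omega))
    refine le_trans ?_ h1
    have := hσ (2 ^ n)
    linarith
end
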